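/- arXiv:1910.03463 — 2 statements merged into one kernel-verified Lean document; each statement's English description precedes it below -/
import Mathlib

section
/- Let N ≥ 1, p ∈ C_N, and affine maps φ_k(x) = r_k x + b_k with r_k > 0 for 0 ≤ k ≤ N, having no common fixed point and satisfying Σ_{j=0}^N p_j log r_j < 0; let ν be the invariant measure. If there exist indices 0 ≤ i ≠ j ≤ N such that log r_i / log r_j is irrational, then ν is Rajchman, i.e. ν̂(t) → 0 as t → +∞. -/
open MeasureTheory Filter Finset

noncomputable section

/-- Fourier transform of a measure on `ℝ`: `μ̂(t) = ∫ e^{2iπtx} dμ(x)`. -/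
def FT (μ : Measure ℝ) (t : ℝ) : ℂ :=
  ∫ x, Complex.exp (2 * (Real.pi : ℂ) * Complex.I * (t : ℂ) * (x : ℂ)) ∂μ

section Renewal

variable {ι : Type*} [Fintype ι] {p ℓ : ι → ℝ}

/-- The transition operator of the random walk with step law `∑ j, p j • δ_{ℓ j}`. -/
def walkOp (p ℓ : ι → ℝ) : (ℝ → ℝ) →ₗ[ℝ] (ℝ → ℝ) where
  toFun f s := ∑ j, p j * f (s + ℓ j)
  map_add' f g := by ext s; simp [mul_add, Finset.sum_add_distrib]
  map_smul' c f := by ext s; simp [Finset.mul_sum, mul_left_comm]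

theorem walkOp_apply (f : ℝ → ℝ) (s : ℝ) : walkOp p ℓ f s = ∑ j, p j * f (s + ℓ j) := rfl

/-- The potential kernel of the walk. -/
def walkGreen (p ℓ : ι → ℝ) (f : ℝ → ℝ) (s : ℝ) : ℝ := ∑' n : ℕ, (walkOp p ℓ ^ n) f s

/-- The Laplace transform of the step law. -/
def walkLaplace (p ℓ : ι → ℝ) (θ : ℝ) : ℝ := ∑ j, p j * Real.exp (θ * ℓ j)

theorem walkLaplace_nonneg (hp : ∀ j, 0 < p j) (θ : ℝ) : 0 ≤ walkLaplace p ℓ θ :=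
  Finset.sum_nonneg fun j _ => mul_nonneg (hp j).le (Real.exp_pos _).le

theorem exists_walkLaplace_lt_one (hp1 : ∑ j, p j = 1) (hneg : ∑ j, p j * ℓ j < 0) :
    ∃ θ, 0 < θ ∧ walkLaplace p ℓ θ < 1 := by
  have hd : HasDerivAt (walkLaplace p ℓ) (∑ j, p j * ℓ j) 0 := by
    unfold walkLaplace
    refine HasDerivAt.fun_sum fun j _ => ?_
    have h1 : HasDerivAt (fun θ : ℝ => Real.exp (θ * ℓ j)) (Real.exp (0 * ℓ j) * (1 * ℓ j)) 0 :=
      ((hasDerivAt_id (0 : ℝ)).mul_const (ℓ j)).exp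
    simpa using h1.const_mul (p j)
  have h0 : walkLaplace p ℓ 0 = 1 := by simp [walkLaplace, hp1]
  have hs := hd.tendsto_slope_zero_right
  obtain ⟨θ, h1, h2⟩ := ((hs.eventually (gt_mem_nhds hneg)).and self_mem_nhdsWithin).exists
  refine ⟨θ, h2, ?_⟩
  simp only [zero_add, h0, smul_eq_mul] at h1 h2
  linarith [neg_of_mul_neg_right h1 (inv_pos.2 h2).le]

theorem walkOp_le_exp (hp : ∀ j, 0 < p j) {θ K : ℝ} {f : ℝ → ℝ}
    (hf : ∀ s, f s ≤ K * Real.exp (θ * s)) (s : ℝ) :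
    walkOp p ℓ f s ≤ K * walkLaplace p ℓ θ * Real.exp (θ * s) := by
  rw [walkOp_apply, walkLaplace, Finset.mul_sum, Finset.sum_mul]
  refine Finset.sum_le_sum fun j _ => ?_
  calc p j * f (s + ℓ j) ≤ p j * (K * Real.exp (θ * (s + ℓ j))) :=
        mul_le_mul_of_nonneg_left (hf _) (hp j).le
    _ = _ := by rw [mul_add, Real.exp_add]; ring

theorem walkOp_pow_le_exp (hp : ∀ j, 0 < p j) {θ K : ℝ} {f : ℝ → ℝ}
    (hf : ∀ s, f s ≤ K * Real.exp (θ * s)) (n : ℕ) (s : ℝ) :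
    (walkOp p ℓ ^ n) f s ≤ K * walkLaplace p ℓ θ ^ n * Real.exp (θ * s) := by
  induction n generalizing s with
  | zero => simpa using hf s
  | succ n ih =>
    rw [pow_succ', Module.End.mul_apply]
    refine (walkOp_le_exp hp ih s).trans_eq ?_
    rw [pow_succ]; ring

theorem abs_walkOp_pow_le_exp (hp : ∀ j, 0 < p j) {θ K : ℝ} {f : ℝ → ℝ}
    (hf : ∀ s, |f s| ≤ K * Real.exp (θ * s)) (n : ℕ) (s : ℝ) :
    |(walkOp p ℓ ^ n) f s| ≤ K * walkLaplace p ℓ θ ^ n * Real.exp (θ * s) := by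
  refine abs_le'.2 ⟨walkOp_pow_le_exp hp (fun s => (le_abs_self _).trans (hf s)) n s, ?_⟩
  have := walkOp_pow_le_exp (ℓ := ℓ) (f := -f) hp (fun s => (neg_le_abs _).trans (hf s)) n s
  simpa using this

theorem summable_walkOp_pow (hp : ∀ j, 0 < p j) {θ K : ℝ} (hθ : walkLaplace p ℓ θ < 1)
    {f : ℝ → ℝ} (hf : ∀ s, |f s| ≤ K * Real.exp (θ * s)) (s : ℝ) :
    Summable fun n : ℕ => (walkOp p ℓ ^ n) f s := by
  refine Summable.of_norm_bounded (f := fun n : ℕ => (walkOp p ℓ ^ n) f s) ?_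
    fun n => abs_walkOp_pow_le_exp hp hf n s
  exact ((summable_geometric_of_lt_one (walkLaplace_nonneg hp θ) hθ).mul_left K).mul_right _

theorem abs_walkGreen_le_exp (hp : ∀ j, 0 < p j) {θ K : ℝ} (hθ : walkLaplace p ℓ θ < 1)
    {f : ℝ → ℝ} (hf : ∀ s, |f s| ≤ K * Real.exp (θ * s)) (s : ℝ) :
    |walkGreen p ℓ f s| ≤ K / (1 - walkLaplace p ℓ θ) * Real.exp (θ * s) := by
  have := ((hasSum_geometric_of_lt_one (walkLaplace_nonneg hp θ) hθ).mul_left K).mul_right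
    (Real.exp (θ * s))
  exact tsum_of_norm_bounded (f := fun n : ℕ => (walkOp p ℓ ^ n) f s) this
    fun n => abs_walkOp_pow_le_exp hp hf n s

theorem walkGreen_eq (hp : ∀ j, 0 < p j) {θ K : ℝ} (hθ : walkLaplace p ℓ θ < 1)
    {f : ℝ → ℝ} (hf : ∀ s, |f s| ≤ K * Real.exp (θ * s)) (s : ℝ) :
    walkGreen p ℓ f s = f s + walkOp p ℓ (walkGreen p ℓ f) s := by
  have hs := summable_walkOp_pow hp hθ hf
  rw [walkGreen, (hs s).tsum_eq_zero_add]
  simp only [pow_zero, Module.End.one_apply, pow_succ', Module.End.mul_apply, walkOp_apply]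
  rw [Summable.tsum_finsetSum fun j _ => (hs (s + ℓ j)).mul_left (p j)]
  simp only [tsum_mul_left, walkGreen]

theorem walkOp_pow_translate (f : ℝ → ℝ) (a : ℝ) (n : ℕ) (s : ℝ) :
    (walkOp p ℓ ^ n) (fun x => f (x + a)) s = (walkOp p ℓ ^ n) f (s + a) := by
  induction n generalizing s with
  | zero => simp
  | succ n ih =>
    simp only [pow_succ', Module.End.mul_apply, walkOp_apply, ih, add_right_comm]

/-- Maximum principle on a half-line for subharmonic functions of a walk with negative drift. -/
theorem walk_le_zero_of_subharmonic (hp : ∀ j, 0 < p j) {θ K C m : ℝ} (hK : 0 ≤ K) (hC0 : 0 ≤ C)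
    (hθ : walkLaplace p ℓ θ < 1) (hC : ∀ j, |ℓ j| ≤ C) {u : ℝ → ℝ}
    (hu : ∀ s, m < s → u s ≤ K * Real.exp (θ * s))
    (hu0 : ∀ s, m - C ≤ s → s ≤ m → u s ≤ 0)
    (hsub : ∀ s, m < s → u s ≤ walkOp p ℓ u s) {s : ℝ} (hs : m < s) : u s ≤ 0 := by
  set v : ℝ → ℝ := fun s => if m < s then max (u s) 0 else 0 with hv
  have hv0 : ∀ s, 0 ≤ v s := fun s => by simp only [hv]; split_ifs <;> simp
  have hvb : ∀ s, v s ≤ K * Real.exp (θ * s) := fun s => by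
    have : 0 ≤ K * Real.exp (θ * s) := by positivity
    simp only [hv]; split_ifs with h
    · exact max_le (hu s h) this
    · exact this
  have hPv0 : ∀ s, 0 ≤ walkOp p ℓ v s := fun s =>
    Finset.sum_nonneg fun j _ => mul_nonneg (hp j).le (hv0 _)
  have huv : ∀ s, m - C ≤ s → u s ≤ v s := fun s h => by
    simp only [hv]; split_ifs with h'
    · exact le_max_left _ _
    · exact hu0 s h (not_lt.1 h')
  have hsv : ∀ s, v s ≤ walkOp p ℓ v s := fun s => by
    by_cases h : m < s
    · have : v s = max (u s) 0 := by simp [hv, h]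
      rw [this]
      refine max_le ((hsub s h).trans (Finset.sum_le_sum fun j _ => ?_)) (hPv0 s)
      refine mul_le_mul_of_nonneg_left (huv _ ?_) (hp j).le
      linarith [(abs_le.1 (hC j)).1]
    · have : v s = 0 := by simp [hv, h]
      rw [this]; exact hPv0 s
  have hn : ∀ n : ℕ, ∀ s, v s ≤ (K * walkLaplace p ℓ θ ^ n) * Real.exp (θ * s) := by
    intro n
    induction n with
    | zero => simpa using hvb
    | succ n ih =>
      intro s
      refine (hsv s).trans ((walkOp_le_exp hp ih s).trans_eq ?_)
      rw [pow_succ]; ring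
  have hlim : Tendsto (fun n : ℕ => (K * walkLaplace p ℓ θ ^ n) * Real.exp (θ * s)) atTop
      (nhds 0) := by
    simpa using ((tendsto_pow_atTop_nhds_zero_of_lt_one (walkLaplace_nonneg hp θ) hθ).const_mul
      K).mul_const (Real.exp (θ * s))
  refine (huv s ?_).trans (ge_of_tendsto' hlim fun n => hn n s)
  linarith

theorem abs_le_mul_exp_of_support {θ ε a b : ℝ} (hθ0 : 0 < θ) {f : ℝ → ℝ}
    (hf : ∀ s, |f s| ≤ ε) (hf0 : ∀ s, s ∉ Set.Icc a b → f s = 0) (s : ℝ) :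
    |f s| ≤ ε * Real.exp (-(θ * a)) * Real.exp (θ * s) := by
  have hε : 0 ≤ ε := (abs_nonneg _).trans (hf 0)
  by_cases h : s ∈ Set.Icc a b
  · refine (hf s).trans ?_
    rw [mul_assoc, ← Real.exp_add]
    refine le_mul_of_one_le_right hε (Real.one_le_exp ?_)
    nlinarith [h.1]
  · rw [hf0 s h, abs_zero]; positivity

theorem abs_walkGreen_le (hp : ∀ j, 0 < p j) (hp1 : ∑ j, p j = 1) {θ C ε a b : ℝ} (hθ0 : 0 < θ)
    (hθ : walkLaplace p ℓ θ < 1) (hC0 : 0 ≤ C) (hC : ∀ j, |ℓ j| ≤ C) {f : ℝ → ℝ}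
    (hf : ∀ s, |f s| ≤ ε) (hf0 : ∀ s, s ∉ Set.Icc a b → f s = 0) (s : ℝ) :
    |walkGreen p ℓ f s| ≤ ε * (Real.exp (θ * (b - a)) / (1 - walkLaplace p ℓ θ)) := by
  have hε : 0 ≤ ε := (abs_nonneg _).trans (hf 0)
  have hρ : 0 < 1 - walkLaplace p ℓ θ := by linarith
  have hexp := abs_le_mul_exp_of_support hθ0 hf hf0
  have hG := abs_walkGreen_le_exp hp hθ hexp
  have hlow : ∀ s ≤ b, |walkGreen p ℓ f s| ≤
      ε * (Real.exp (θ * (b - a)) / (1 - walkLaplace p ℓ θ)) := fun s hs => by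
    refine (hG s).trans ?_
    have : Real.exp (θ * s) ≤ Real.exp (θ * b) := Real.exp_le_exp.2 (by nlinarith)
    calc _ ≤ ε * Real.exp (-(θ * a)) / (1 - walkLaplace p ℓ θ) * Real.exp (θ * b) := by gcongr
      _ = _ := by rw [show θ * (b - a) = -(θ * a) + θ * b by ring, Real.exp_add]; ring
  set M := ε * (Real.exp (θ * (b - a)) / (1 - walkLaplace p ℓ θ)) with hM
  have hM0 : 0 ≤ M := by positivity
  have key : ∀ c : ℝ, |c| = 1 → ∀ s, b < s → c * walkGreen p ℓ f s - M ≤ 0 := by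
    intro c hc s hs
    have habs : ∀ s, c * walkGreen p ℓ f s ≤ |walkGreen p ℓ f s| := fun s => by
      refine (le_abs_self _).trans ?_
      rw [abs_mul, hc, one_mul]
    refine walk_le_zero_of_subharmonic (u := fun s => c * walkGreen p ℓ f s - M)
      hp (K := ε * Real.exp (-(θ * a)) / (1 - walkLaplace p ℓ θ)) (by positivity) hC0 hθ hC
      (fun s _ => by linarith [habs s, hG s]) (fun s _ h => by linarith [habs s, hlow s h])
      (fun s h => ?_) hs
    rw [walkGreen_eq hp hθ hexp, hf0 s (fun h' => absurd h'.2 (not_le.2 h)), zero_add,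
      walkOp_apply, walkOp_apply]
    simp only [mul_sub, Finset.sum_sub_distrib, ← Finset.sum_mul, hp1, one_mul, Finset.mul_sum]
    refine (sub_le_sub_right (Finset.sum_le_sum fun j _ => ?_) _)
    exact (mul_left_comm _ _ _).le
  by_cases hs : s ≤ b
  · exact hlow s hs
  · have h1 := key 1 (by simp) s (not_le.1 hs)
    have h2 := key (-1) (by simp) s (not_le.1 hs)
    exact abs_le.2 ⟨by linarith, by linarith⟩

theorem walkGreen_sub_translate (hp : ∀ j, 0 < p j) {θ K K' a : ℝ}
    (hθ : walkLaplace p ℓ θ < 1) {f : ℝ → ℝ} (hf : ∀ s, |f s| ≤ K * Real.exp (θ * s))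
    (hf' : ∀ s, |f (s + a)| ≤ K' * Real.exp (θ * s)) (s : ℝ) :
    walkGreen p ℓ (fun x => f (x + a) - f x) s = walkGreen p ℓ f (s + a) - walkGreen p ℓ f s := by
  have h1 := summable_walkOp_pow (ℓ := ℓ) hp hθ hf s
  have h2 := summable_walkOp_pow (ℓ := ℓ) (f := fun x => f (x + a)) hp hθ hf' s
  have h3 : ∀ n : ℕ, (walkOp p ℓ ^ n) (fun x => f (x + a) - f x) s =
      (walkOp p ℓ ^ n) (fun x => f (x + a)) s - (walkOp p ℓ ^ n) f s := fun n => by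
    rw [show (fun x => f (x + a) - f x) = (fun x => f (x + a)) - f from rfl, map_sub, Pi.sub_apply]
  simp only [walkGreen, h3]
  rw [h2.tsum_sub h1]
  simp only [walkOp_pow_translate]

theorem uniformContinuous_walkGreen (hp : ∀ j, 0 < p j) (hp1 : ∑ j, p j = 1) {θ C a b : ℝ}
    (hθ0 : 0 < θ) (hθ : walkLaplace p ℓ θ < 1) (hC0 : 0 ≤ C) (hC : ∀ j, |ℓ j| ≤ C) {f : ℝ → ℝ}
    (hfc : Continuous f) (hf0 : ∀ s, s ∉ Set.Icc a b → f s = 0) :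
    UniformContinuous (walkGreen p ℓ f) := by
  have hcs : HasCompactSupport f := HasCompactSupport.intro isCompact_Icc hf0
  have huc := hcs.uniformContinuous_of_continuous hfc
  obtain ⟨M, hM⟩ := hcs.exists_bound_of_continuous hfc
  rw [Metric.uniformContinuous_iff] at huc ⊢
  intro ε hε
  set D := Real.exp (θ * ((b + 1) - (a - 1))) / (1 - walkLaplace p ℓ θ) with hD
  have hρ : 0 < 1 - walkLaplace p ℓ θ := by linarith
  have hD0 : 0 < D := by positivity
  obtain ⟨δ, hδ, hd⟩ := huc (ε / (2 * D)) (by positivity)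
  refine ⟨min δ 1, by positivity, fun {x y} hxy => ?_⟩
  rw [Real.dist_eq, lt_min_iff] at hxy
  have hz : ∀ s, s ∉ Set.Icc (a - 1) (b + 1) → f (s + (x - y)) = 0 := fun s hs => hf0 _ fun h =>
    hs ⟨by linarith [h.1, (abs_lt.1 hxy.2).2], by linarith [h.2, (abs_lt.1 hxy.2).1]⟩
  have hz' : ∀ s, s ∉ Set.Icc (a - 1) (b + 1) → f s = 0 := fun s hs => hf0 _ fun h =>
    hs ⟨by linarith [h.1], by linarith [h.2]⟩
  have h := walkGreen_sub_translate (ℓ := ℓ) (a := x - y) hp hθ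
    (abs_le_mul_exp_of_support hθ0 hM hz')
    (abs_le_mul_exp_of_support (f := fun s => f (s + (x - y))) hθ0 (fun s => hM _) hz) y
  rw [add_sub_cancel] at h
  rw [Real.dist_eq, ← h]
  refine (abs_walkGreen_le (a := a - 1) (b := b + 1) (ε := ε / (2 * D)) hp hp1 hθ0 hθ hC0 hC
    (fun s => ?_) (fun s hs => ?_) y).trans_lt ?_
  · have := @hd (s + (x - y)) s (by rw [Real.dist_eq]; simpa using hxy.1)
    exact this.le
  · rw [hz s hs, hz' s hs, sub_zero]
  · rw [← hD]
    have : ε / (2 * D) * D = ε / 2 := by field_simp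
    linarith

theorem walk_eventually_le_of_sum_bounded [DecidableEq ι] (hp : ∀ j, 0 < p j)
    (hp1 : ∑ j, p j = 1) {D : ℝ → ℝ} {K : ℝ} (hK : ∀ s, |D s| ≤ K)
    (hD : ∀ᶠ s in atTop, D s = walkOp p ℓ D s) (j : ι) {C : ℝ}
    (hC : ∀ (n : ℕ) s, ∑ k ∈ Finset.range n, D (s + k * ℓ j) ≤ C) {ε : ℝ} (hε : 0 < ε) :
    ∀ᶠ s in atTop, D s < ε := by
  have hbd : IsBoundedUnder (· ≤ ·) atTop D := isBoundedUnder_of ⟨K, fun s => (abs_le.1 (hK s)).2⟩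
  have hbd' : IsCoboundedUnder (· ≤ ·) atTop D :=
    (isBoundedUnder_of ⟨-K, fun s => (abs_le.1 (hK s)).1⟩ :
      IsBoundedUnder (· ≥ ·) atTop D).isCoboundedUnder_flip
  set d := limsup D atTop with hd
  obtain ⟨F, hFle, hFd⟩ := mapClusterPt_iff_ultrafilter.1 (MapClusterPt.limsup hbd' hbd)
  have hlt : ∀ η > 0, ∀ᶠ s in atTop, D s < d + η := fun η hη =>
    eventually_lt_of_limsup_lt (by linarith) hbd
  have hstep : ∀ a, Tendsto (fun s => D (s + a)) F (nhds d) →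
      Tendsto (fun s => D (s + (a + ℓ j))) F (nhds d) := by
    intro a ha
    have htr : ∀ b : ℝ, Tendsto (fun s => s + b) F atTop := fun b =>
      (tendsto_atTop_add_const_right _ b tendsto_id).mono_left hFle
    rw [tendsto_order] at ha ⊢
    refine ⟨fun c hc => ?_, fun c hc => ?_⟩
    · set η := p j * (d - c) / 2 with hη
      have hη0 : 0 < η := by have := hp j; have := sub_pos.2 hc; positivity
      have h1 : ∀ᶠ s in (F : Filter ℝ), ∀ i, D (s + (a + ℓ i)) < d + η :=
        eventually_all.2 fun i => (htr _).eventually (hlt η hη0)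
      filter_upwards [h1, ha.1 (d - η) (by linarith), (htr a).eventually hD] with s h1 h2 h3
      rw [walkOp_apply, ← Finset.add_sum_erase _ _ (Finset.mem_univ j)] at h3
      have h4 : ∑ i ∈ Finset.univ.erase j, p i * D (s + a + ℓ i) ≤
          ∑ i ∈ Finset.univ.erase j, p i * (d + η) :=
        Finset.sum_le_sum fun i _ => mul_le_mul_of_nonneg_left
          (by rw [add_assoc]; exact (h1 i).le) (hp i).le
      have h5 := Finset.add_sum_erase _ p (Finset.mem_univ j)
      rw [← Finset.sum_mul, eq_sub_of_add_eq' h5, hp1] at h4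
      rw [add_assoc] at h3
      have h6 : p j * c < p j * D (s + (a + ℓ j)) := by
        have := mul_pos (hp j) hη0
        nlinarith
      exact lt_of_mul_lt_mul_left h6 (hp j).le
    · filter_upwards [(htr (a + ℓ j)).eventually (hlt (c - d) (by linarith))] with s hs
      linarith
  have hall : ∀ n : ℕ, Tendsto (fun s => D (s + n * ℓ j)) F (nhds d) := fun n => by
    induction n with
    | zero => simpa using hFd
    | succ n ih =>
      have := hstep _ ih
      simpa [add_mul] using this
  have hnd : ∀ n : ℕ, n * d ≤ C := fun n => by
    have := tendsto_finsetSum (Finset.range n) fun k _ => hall k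
    simp only [Finset.sum_const, Finset.card_range, nsmul_eq_mul] at this
    exact le_of_tendsto' this (hC n)
  have hd0 : d ≤ 0 := by
    by_contra! h
    obtain ⟨n, hn⟩ := exists_nat_gt (C / d)
    rw [div_lt_iff₀ h] at hn
    linarith [hnd n]
  filter_upwards [hlt ε hε] with s hs
  linarith

theorem walkGreen_translate_sub_tendsto (hp : ∀ j, 0 < p j)
    (hp1 : ∑ j, p j = 1) {h : ℝ → ℝ} {K : ℝ} (hK : ∀ s, |h s| ≤ K)
    (hh : ∀ᶠ s in atTop, h s = walkOp p ℓ h s) (k : ι) :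
    Tendsto (fun s => h (s + ℓ k) - h s) atTop (nhds 0) := by
  classical
  have hb : ∀ s s', h s - h s' ≤ 2 * K := fun s s' => by
    linarith [(abs_le.1 (hK s)).2, (abs_le.1 (hK s')).1]
  have hD : ∀ᶠ s in atTop, h (s + ℓ k) - h s = walkOp p ℓ (fun s => h (s + ℓ k) - h s) s := by
    filter_upwards [hh, (tendsto_atTop_add_const_right _ (ℓ k) tendsto_id).eventually hh]
      with s h1 h2
    rw [id_eq] at h2
    rw [h1, h2]
    simp only [walkOp_apply, mul_sub, Finset.sum_sub_distrib, add_right_comm]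
  have htel : ∀ (n : ℕ) s, ∑ m ∈ Finset.range n, (h (s + m * ℓ k + ℓ k) - h (s + m * ℓ k)) =
      h (s + n * ℓ k) - h s := fun n s => by
    have := Finset.sum_range_sub (fun m : ℕ => h (s + m * ℓ k)) n
    simp only [Nat.cast_add, Nat.cast_one, add_mul, one_mul, Nat.cast_zero, zero_mul, add_zero,
      ← add_assoc] at this
    exact this
  rw [tendsto_order]
  refine ⟨fun c hc => ?_, fun c hc => ?_⟩
  · have := walk_eventually_le_of_sum_bounded (ℓ := ℓ) (D := fun s => -(h (s + ℓ k) - h s))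
      (K := 2 * K) (C := 2 * K) hp hp1
      (fun s => by rw [abs_neg, abs_le]; constructor <;> linarith [hb (s + ℓ k) s, hb s (s + ℓ k)])
      (hD.mono fun s hs => by
        rw [hs]; simp only [walkOp_apply, mul_neg, Finset.sum_neg_distrib]) k
      (fun n s => by rw [Finset.sum_neg_distrib, htel, neg_sub]; exact hb _ _) (neg_pos.2 hc)
    filter_upwards [this] with s hs
    linarith
  · exact walk_eventually_le_of_sum_bounded (ℓ := ℓ) (D := fun s => h (s + ℓ k) - h s)
      (K := 2 * K) (C := 2 * K) hp hp1
      (fun s => by rw [abs_le]; constructor <;> linarith [hb (s + ℓ k) s, hb s (s + ℓ k)])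
      hD k (fun n s => by rw [htel]; exact hb _ _) hc

theorem tendsto_translate_sub_of_irrational {h : ℝ → ℝ} (hu : UniformContinuous h) {a b : ℝ}
    (hirr : Irrational (a / b)) (ha : Tendsto (fun s => h (s + a) - h s) atTop (nhds 0))
    (hb : Tendsto (fun s => h (s + b) - h s) atTop (nhds 0)) (c : ℝ) :
    Tendsto (fun s => h (s + c) - h s) atTop (nhds 0) := by
  have htr : ∀ b : ℝ, Tendsto (fun s => s + b) atTop (atTop : Filter ℝ) := fun b =>
    tendsto_atTop_add_const_right _ b tendsto_id
  let T : AddSubgroup ℝ :=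
    { carrier := {a | Tendsto (fun s => h (s + a) - h s) atTop (nhds 0)}
      zero_mem' := by simp
      add_mem' := fun {x y} hx hy => by
        have := (Tendsto.comp hx (htr y)).add hy
        simp only [add_zero] at this
        refine this.congr fun s => ?_
        simp only [Function.comp_apply]
        rw [show s + y + x = s + (x + y) by ring]; ring
      neg_mem' := fun {x} hx => by
        have := (Tendsto.comp hx (htr (-x))).neg
        simp only [neg_zero] at this
        refine this.congr fun s => ?_
        simp }
  have hdense : Dense (T : Set ℝ) := by
    refine (dense_addSubgroupClosure_pair_iff.2 hirr).mono ?_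
    rw [SetLike.coe_subset_coe, AddSubgroup.closure_le]
    rintro x (rfl | rfl)
    · exact ha
    · exact hb
  rw [Metric.tendsto_nhds]
  intro ε hε
  obtain ⟨δ, hδ, hd⟩ := Metric.uniformContinuous_iff.1 hu (ε / 2) (by positivity)
  obtain ⟨x, hxT, hx⟩ := Metric.dense_iff.1 hdense c δ hδ
  have hx' : Tendsto (fun s => h (s + x) - h s) atTop (nhds 0) := hx
  filter_upwards [(Metric.tendsto_nhds.1 hx') (ε / 2) (by positivity)] with s hs
  have h1 := @hd (s + c) (s + x) (by rw [dist_add_left, dist_comm]; exact hxT)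
  rw [Real.dist_eq] at h1 hs ⊢
  rw [sub_zero] at hs ⊢
  rw [abs_lt] at *
  constructor <;> linarith [h1.1, h1.2, hs.1, hs.2]

/-- The renewal theorem for a walk with negative drift and a non-lattice step law. -/
theorem walkGreen_tendsto (hp : ∀ j, 0 < p j) (hp1 : ∑ j, p j = 1) (hneg : ∑ j, p j * ℓ j < 0)
    {i j : ι} (hirr : Irrational (ℓ i / ℓ j)) {f : ℝ → ℝ} {a b : ℝ}
    (hfc : Continuous f) (hf0 : ∀ s, s ∉ Set.Icc a b → f s = 0) :
    Tendsto (walkGreen p ℓ f) atTop (nhds ((∫ x in a..b, f x) / -∑ j, p j * ℓ j)) := by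
  obtain ⟨θ, hθ0, hθ⟩ := exists_walkLaplace_lt_one hp1 hneg
  have hcs : HasCompactSupport f := HasCompactSupport.intro isCompact_Icc hf0
  obtain ⟨M, hM⟩ := hcs.exists_bound_of_continuous hfc
  have hexp := abs_le_mul_exp_of_support hθ0 hM hf0
  set C := ∑ j, |ℓ j| with hCdef
  have hC0 : 0 ≤ C := Finset.sum_nonneg fun j _ => abs_nonneg _
  have hC : ∀ j, |ℓ j| ≤ C := fun j =>
    Finset.single_le_sum (f := fun j => |ℓ j|) (fun j _ => abs_nonneg _) (Finset.mem_univ j)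
  set h := walkGreen p ℓ f with hh
  have hu : UniformContinuous h := uniformContinuous_walkGreen hp hp1 hθ0 hθ hC0 hC hfc hf0
  have hc := hu.continuous
  obtain ⟨K, hK⟩ : ∃ K, ∀ s, |h s| ≤ K := ⟨_, abs_walkGreen_le hp hp1 hθ0 hθ hC0 hC hM hf0⟩
  have heq := walkGreen_eq (ℓ := ℓ) hp hθ hexp
  have hev : ∀ᶠ s in atTop, h s = walkOp p ℓ h s := by
    filter_upwards [eventually_gt_atTop b] with s hs
    rw [hh, heq s, hf0 s (fun h' => absurd h'.2 (not_le.2 hs)), zero_add]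
  have hper := tendsto_translate_sub_of_irrational hu hirr
    (walkGreen_translate_sub_tendsto hp hp1 hK hev i)
    (walkGreen_translate_sub_tendsto hp hp1 hK hev j)
  set q : ℝ → ℝ := fun x => ∑ j, p j * ∫ y in (0 : ℝ)..ℓ j, h (x + y) with hq
  have hqd : ∀ x, HasDerivAt q (-f x) x := fun x => by
    have hprim : ∀ x, HasDerivAt (fun x => ∫ y in (0 : ℝ)..x, h y) (h x) x := fun x =>
      intervalIntegral.integral_hasDerivAt_right (hc.intervalIntegrable _ _)
        hc.aestronglyMeasurable.stronglyMeasurableAtFilter hc.continuousAt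
    have hq' : q = fun x =>
        ∑ j, p j * ((∫ y in (0 : ℝ)..(x + ℓ j), h y) - ∫ y in (0 : ℝ)..x, h y) := by
      ext x
      refine Finset.sum_congr rfl fun j _ => ?_
      rw [intervalIntegral.integral_comp_add_left, add_zero,
        intervalIntegral.integral_interval_sub_left (hc.intervalIntegrable _ _)
          (hc.intervalIntegrable _ _)]
    have : -f x = ∑ j, p j * (h (x + ℓ j) - h x) := by
      simp only [mul_sub, Finset.sum_sub_distrib, ← Finset.sum_mul, hp1, one_mul]
      have := heq x
      rw [walkOp_apply] at this
      linarith
    rw [hq', this]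
    exact HasDerivAt.fun_sum fun j _ =>
      (((hprim (x + ℓ j)).comp_add_const x (ℓ j)).sub (hprim x)).const_mul (p j)
  have hqint : ∀ x y, q x - q y = -∫ t in y..x, f t := fun x y => by
    rw [← intervalIntegral.integral_neg]
    exact (intervalIntegral.integral_eq_sub_of_hasDerivAt (fun t _ => hqd t)
      (hfc.neg.intervalIntegrable _ _)).symm
  have hlim0 : Tendsto h atBot (nhds 0) := by
    refine squeeze_zero_norm (abs_walkGreen_le_exp hp hθ hexp) ?_
    simpa using (Real.tendsto_exp_atBot.comp (tendsto_id.const_mul_atBot hθ0)).const_mul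
      (M * Real.exp (-(θ * a)) / (1 - walkLaplace p ℓ θ))
  have hlimint : ∀ {l : Filter ℝ} [l.IsCountablyGenerated] {g : ℝ → ℝ → ℝ} {B : ℝ},
      (∀ x, Continuous (g x)) → (∀ x y, |g x y| ≤ B) →
      (∀ y, Tendsto (fun x => g x y) l (nhds 0)) →
      Tendsto (fun x => ∑ j, p j * ∫ y in (0 : ℝ)..ℓ j, g x y) l (nhds 0) := by
    intro l _ g B hg hB ht
    suffices Tendsto (fun x => ∑ j, p j * ∫ y in (0 : ℝ)..ℓ j, g x y) l
        (nhds (∑ j, p j * ∫ y in (0 : ℝ)..ℓ j, (0 : ℝ))) by simpa using this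
    refine tendsto_finsetSum _ fun j _ => Tendsto.const_mul _ ?_
    exact intervalIntegral.tendsto_integral_filter_of_dominated_convergence (fun _ => B)
      (Eventually.of_forall fun x => (hg x).aestronglyMeasurable)
      (Eventually.of_forall fun x => ae_of_all _ fun y _ => hB x y)
      intervalIntegrable_const (ae_of_all _ fun y _ => ht y)
  have hqbot : Tendsto q atBot (nhds 0) :=
    hlimint (g := fun x y => h (x + y)) (fun x => by fun_prop) (fun x y => hK _) fun y =>
      hlim0.comp (tendsto_atBot_add_const_right _ y tendsto_id)
  have hqtop : ∀ x, b ≤ x → q x = -∫ t in a..b, f t := by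
    intro x hx
    have hzero : ∀ u v, (∀ t ∈ Set.uIoo u v, t ∉ Set.Icc a b) → ∫ t in u..v, f t = 0 := by
      intro u v huv
      have : ∫ t in u..v, f t = ∫ _ in u..v, (0 : ℝ) :=
        intervalIntegral.integral_congr_uIoo fun t ht => hf0 t (huv t ht)
      simpa using this
    have : ∀ᶠ y in atBot, q y = q x + ∫ t in a..b, f t := by
      filter_upwards [eventually_le_atBot a] with y hy
      have h1 : ∫ t in y..a, f t = 0 := hzero _ _ fun t ht h' => by
        rw [Set.uIoo_of_le hy] at ht
        exact absurd ht.2 (not_lt.2 h'.1)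
      have h2 : ∫ t in b..x, f t = 0 := hzero _ _ fun t ht h' => by
        rw [Set.uIoo_of_le hx] at ht
        exact absurd ht.1 (not_lt.2 h'.2)
      have h3 := hqint x y
      rw [← intervalIntegral.integral_add_adjacent_intervals (hfc.intervalIntegrable y a)
        (hfc.intervalIntegrable a x), ← intervalIntegral.integral_add_adjacent_intervals
        (hfc.intervalIntegrable a b) (hfc.intervalIntegrable b x), h1, h2] at h3
      linarith
    have := tendsto_nhds_unique (tendsto_const_nhds.congr' (this.mono fun y hy => hy.symm)) hqbot
    linarith
  have hqh : Tendsto (fun x => q x - (∑ j, p j * ℓ j) * h x) atTop (nhds 0) := by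
    refine (hlimint (l := atTop) (B := 2 * K) (g := fun x y => h (x + y) - h x)
      (fun x => by fun_prop) (fun x y => ?_) hper).congr fun x => ?_
    · linarith [abs_sub (h (x + y)) (h x), hK (x + y), hK x]
    · rw [hq, Finset.sum_mul, ← Finset.sum_sub_distrib]
      refine Finset.sum_congr rfl fun j _ => ?_
      rw [intervalIntegral.integral_sub (Continuous.intervalIntegrable (by fun_prop) _ _)
        intervalIntegrable_const, intervalIntegral.integral_const, sub_zero, smul_eq_mul]
      ring
  have hfin := (tendsto_const_nhds (x := -∫ t in a..b, f t)).sub hqh |>.div_const (∑ j, p j * ℓ j)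
  rw [sub_zero, neg_div, ← div_neg] at hfin
  refine hfin.congr' ?_
  filter_upwards [eventually_ge_atTop b] with x hx
  rw [hqtop x hx]
  have := hneg.ne
  field_simp
  ring

theorem tendsto_zero_of_subharmonic (hp : ∀ j, 0 < p j) (hp1 : ∑ j, p j = 1)
    (hneg : ∑ j, p j * ℓ j < 0) {i j : ι} (hirr : Irrational (ℓ i / ℓ j)) {w : ℝ → ℝ}
    (hw : Continuous w) (hw0 : ∀ s, 0 ≤ w s) (hw1 : ∀ s, w s ≤ 1)
    (hsub : ∀ s, w s ≤ walkOp p ℓ w s)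
    (hmean : ∀ D, 0 < D → Tendsto (fun m => ∫ s in (m - D)..(m + D), w s) atTop (nhds 0)) :
    Tendsto w atTop (nhds 0) := by
  obtain ⟨θ, hθ0, hθ⟩ := exists_walkLaplace_lt_one hp1 hneg
  have hρ : 0 < 1 - walkLaplace p ℓ θ := by linarith
  set C := ∑ j, |ℓ j| with hCdef
  have hC0 : 0 ≤ C := Finset.sum_nonneg fun j _ => abs_nonneg _
  have hC : ∀ j, |ℓ j| ≤ C := fun j =>
    Finset.single_le_sum (f := fun j => |ℓ j|) (fun j _ => abs_nonneg _) (Finset.mem_univ j)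
  set lam := -∑ j, p j * ℓ j with hlam
  have hlam0 : 0 < lam := by linarith
  rw [Metric.tendsto_nhds]
  intro ε hε
  obtain ⟨m, hm⟩ := (((hmean (C + 1) (by positivity)).div_const lam).eventually
    (gt_mem_nhds (by simpa using hε))).exists
  set χ : ℝ → ℝ := fun s => max 0 (min 1 (C + 1 - |s - m|)) with hχ
  have hχ0 : ∀ s, 0 ≤ χ s := fun s => le_max_left _ _
  have hχ1 : ∀ s, χ s ≤ 1 := fun s => max_le zero_le_one (min_le_left _ _)
  set f : ℝ → ℝ := fun s => w s * χ s with hf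
  have hfc : Continuous f := by fun_prop
  have hf0 : ∀ s, 0 ≤ f s := fun s => mul_nonneg (hw0 s) (hχ0 s)
  have hfw : ∀ s, f s ≤ w s := fun s => mul_le_of_le_one_right (hw0 s) (hχ1 s)
  have hfabs : ∀ s, |f s| ≤ 1 := fun s => by
    rw [abs_of_nonneg (hf0 s)]; exact (hfw s).trans (hw1 s)
  have hfs : ∀ s, s ∉ Set.Icc (m - (C + 1)) (m + (C + 1)) → f s = 0 := fun s hs => by
    have : C + 1 ≤ |s - m| := by
      by_contra! h
      exact hs ⟨by linarith [(abs_lt.1 h).1], by linarith [(abs_lt.1 h).2]⟩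
    have : χ s = 0 := max_eq_left ((min_le_right _ _).trans (by linarith))
    simp [hf, this]
  have hexp := abs_le_mul_exp_of_support hθ0 hfabs hfs
  have hab : m - (C + 1) ≤ m + (C + 1) := by linarith
  have hGlim := walkGreen_tendsto hp hp1 hneg hirr hfc hfs
  have hfw_int : ∫ s in (m - (C + 1))..(m + (C + 1)), f s ≤
      ∫ s in (m - (C + 1))..(m + (C + 1)), w s :=
    intervalIntegral.integral_mono_on hab (hfc.intervalIntegrable _ _)
      (hw.intervalIntegrable _ _) fun s _ => hfw s
  have hGlt : ∀ᶠ s in atTop, walkGreen p ℓ f s < ε := by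
    refine hGlim.eventually (gt_mem_nhds (lt_of_le_of_lt ?_ hm))
    exact div_le_div_of_nonneg_right hfw_int hlam0.le
  have hG0 : ∀ s, 0 ≤ walkGreen p ℓ f s := fun s => tsum_nonneg fun n => by
    induction n generalizing s with
    | zero => simpa using hf0 s
    | succ n ih =>
      rw [pow_succ', Module.End.mul_apply, walkOp_apply]
      exact Finset.sum_nonneg fun j _ => mul_nonneg (hp j).le (ih _)
  have heq := walkGreen_eq (ℓ := ℓ) hp hθ hexp
  have hle : ∀ s, m < s → w s - walkGreen p ℓ f s ≤ 0 := fun s hs => by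
    refine walk_le_zero_of_subharmonic (u := w - walkGreen p ℓ f) hp
      (K := Real.exp (-(θ * m))) (Real.exp_pos _).le hC0 hθ hC (fun s hs => ?_)
      (fun s h1 h2 => ?_) (fun s _ => ?_) hs
    · have : 1 ≤ Real.exp (-(θ * m)) * Real.exp (θ * s) := by
        rw [← Real.exp_add]; exact Real.one_le_exp (by nlinarith)
      simp only [Pi.sub_apply]
      linarith [hG0 s, hw1 s]
    · have h3 : |s - m| ≤ C := abs_le.2 ⟨by linarith, by linarith⟩
      have h4 : χ s = 1 := by
        simp only [hχ]
        rw [min_eq_left (by linarith), max_eq_right zero_le_one]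
      have h5 : f s = w s := by simp [hf, h4]
      have h6 : 0 ≤ walkOp p ℓ (walkGreen p ℓ f) s :=
        Finset.sum_nonneg fun j _ => mul_nonneg (hp j).le (hG0 _)
      have := heq s
      simp only [Pi.sub_apply]
      linarith
    · rw [map_sub, Pi.sub_apply, Pi.sub_apply]
      linarith [heq s, hsub s, hf0 s]
  filter_upwards [hGlt, eventually_gt_atTop m] with s h1 h2
  rw [Real.dist_eq, sub_zero, abs_of_nonneg (hw0 s)]
  linarith [hle s h2]

end Renewal

theorem tendsto_sinc_mul_atTop {x : ℝ} (hx : x ≠ 0) :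
    Tendsto (fun r : ℝ => Real.sinc (r * x)) atTop (nhds 0) := by
  have hinv : Tendsto (fun r : ℝ => r⁻¹ * |x|⁻¹) atTop (nhds 0) := by
    simpa using tendsto_inv_atTop_zero.mul_const |x|⁻¹
  refine squeeze_zero_norm' ?_ hinv
  filter_upwards [eventually_gt_atTop 0] with r hr
  rw [Real.sinc_of_ne_zero (mul_ne_zero hr.ne' hx), norm_div, Real.norm_eq_abs, Real.norm_eq_abs,
    abs_mul, abs_of_pos hr, ← mul_inv, div_eq_mul_inv]
  exact mul_le_of_le_one_left (by positivity) (Real.abs_sin_le_one _)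

/-- Wiener's lemma: the mean square of the characteristic function of a continuous probability
measure vanishes. -/
theorem tendsto_average_norm_charFun_sq (ν : Measure ℝ) [IsProbabilityMeasure ν] [NullSingletonClass ν] :
    Tendsto (fun r => r⁻¹ * ∫ t in -r..r, ‖charFun ν t‖ ^ 2) atTop (nhds 0) := by
  set μ := (ν.prod (ν.map (-1 * ·))).map (fun z => z.1 + z.2) with hμ
  have : IsProbabilityMeasure (ν.map (-1 * ·)) :=
    Measure.isProbabilityMeasure_map (by fun_prop)
  have : IsProbabilityMeasure μ := Measure.isProbabilityMeasure_map (by fun_prop)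
  have hchar : ∀ t, charFun μ t = ((‖charFun ν t‖ ^ 2 : ℝ) : ℂ) := fun t => by
    rw [hμ, ProbabilityTheory.charFun_map_add_prod_eq_mul, Pi.mul_apply, charFun_map_mul,
      neg_one_mul, charFun_neg, Complex.mul_conj, Complex.normSq_eq_norm_sq]
  have hzero : μ {0} = 0 := by
    have hm : MeasurableSet ((fun z : ℝ × ℝ => z.1 + z.2) ⁻¹' {0}) :=
      (measurable_fst.add measurable_snd) (measurableSet_singleton 0)
    rw [hμ, Measure.map_apply (by fun_prop) (measurableSet_singleton 0),
      Measure.prod_apply_symm hm]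
    refine lintegral_eq_zero_of_ae_eq_zero (ae_of_all _ fun y => ?_)
    have : (fun x : ℝ => (x, y)) ⁻¹' ((fun z : ℝ × ℝ => z.1 + z.2) ⁻¹' {0}) = {-y} := by
      ext x; simp [eq_neg_iff_add_eq_zero]
    simp [this]
  have hsinc : Tendsto (fun r : ℝ => ∫ x, Real.sinc (r * x) ∂μ) atTop (nhds 0) := by
    have hcont := Real.continuous_sinc
    rw [← integral_zero ℝ ℝ (μ := μ)]
    refine tendsto_integral_filter_of_dominated_convergence (fun _ => 1)
      (Eventually.of_forall fun r => (by fun_prop : Continuous _).aestronglyMeasurable)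
      (Eventually.of_forall fun r => ae_of_all _ fun x => Real.abs_sinc_le_one _)
      (integrable_const _) ?_
    have hne : ∀ᵐ x ∂μ, x ≠ 0 := by simpa [ae_iff] using hzero
    filter_upwards [hne] with x hx
    exact tendsto_sinc_mul_atTop hx
  have h2 := hsinc.const_mul 2
  rw [mul_zero] at h2
  refine h2.congr' ?_
  filter_upwards [eventually_gt_atTop 0] with r hr
  have h := integral_charFun_Icc (μ := μ) hr
  simp only [hchar] at h
  rw [intervalIntegral.integral_ofReal] at h
  have h' : ∫ t in -r..r, ‖charFun ν t‖ ^ 2 = 2 * r * ∫ x, Real.sinc (r * x) ∂μ := by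
    exact_mod_cast h
  rw [h']
  field_simp

theorem tendsto_integral_norm_charFun_exp_sq (ν : Measure ℝ) [IsProbabilityMeasure ν]
    [NullSingletonClass ν] {D : ℝ} (hD : 0 < D) :
    Tendsto (fun m => ∫ s in (m - D)..(m + D), ‖charFun ν (Real.exp s)‖ ^ 2) atTop (nhds 0) := by
  have hc : Continuous fun t => ‖charFun ν t‖ ^ 2 := by fun_prop
  have hlim := (((tendsto_average_norm_charFun_sq ν).comp
    (Real.tendsto_exp_atTop.comp (tendsto_atTop_add_const_right _ D tendsto_id))).const_mul
      (Real.exp (2 * D)))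
  rw [mul_zero] at hlim
  refine squeeze_zero (fun m => ?_) (fun m => ?_) hlim
  · exact intervalIntegral.integral_nonneg (by linarith) fun s _ => by positivity
  · simp only [Function.comp_apply, id_eq]
    have hsub : ∫ s in (m - D)..(m + D), ‖charFun ν (Real.exp s)‖ ^ 2 * Real.exp s =
        ∫ t in Real.exp (m - D)..Real.exp (m + D), ‖charFun ν t‖ ^ 2 :=
      intervalIntegral.integral_comp_mul_deriv (g := fun t => ‖charFun ν t‖ ^ 2)
        (fun s _ => Real.hasDerivAt_exp s) Real.continuous_exp.continuousOn hc
    have h1 : ∫ s in (m - D)..(m + D), ‖charFun ν (Real.exp s)‖ ^ 2 ≤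
        ∫ s in (m - D)..(m + D),
          Real.exp (-(m - D)) * (‖charFun ν (Real.exp s)‖ ^ 2 * Real.exp s) := by
      refine intervalIntegral.integral_mono_on (by linarith)
        (Continuous.intervalIntegrable (by fun_prop) _ _)
        (Continuous.intervalIntegrable (by fun_prop) _ _) fun s hs => ?_
      rw [mul_left_comm, ← Real.exp_add]
      exact le_mul_of_one_le_right (by positivity) (Real.one_le_exp (by linarith [hs.1]))
    have h2 : ∫ t in Real.exp (m - D)..Real.exp (m + D), ‖charFun ν t‖ ^ 2 ≤
        ∫ t in -Real.exp (m + D)..Real.exp (m + D), ‖charFun ν t‖ ^ 2 :=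
      intervalIntegral.integral_mono_interval
        (by linarith [Real.exp_pos (m - D), Real.exp_pos (m + D)])
        (Real.exp_le_exp.2 (by linarith)) le_rfl
        (ae_of_all _ fun t => by positivity) (hc.intervalIntegrable _ _)
    rw [intervalIntegral.integral_const_mul, hsub] at h1
    refine h1.trans ((mul_le_mul_of_nonneg_left h2 (Real.exp_pos _).le).trans_eq ?_)
    rw [← mul_assoc, ← Real.exp_neg, ← Real.exp_add]
    ring_nf

section Invariant

variable {ι : Type*} [Fintype ι] {r b p : ι → ℝ} {ν : Measure ℝ}

theorem invariant_measure_singleton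
    (hr : ∀ k, 0 < r k)
    (hν : ν = ∑ j, ENNReal.ofReal (p j) • ν.map (fun x => r j * x + b j)) (x : ℝ) :
    ν {x} = ∑ j, ENNReal.ofReal (p j) * ν {(x - b j) / r j} := by
  conv_lhs => rw [hν]
  rw [Measure.finsetSum_apply]
  refine Finset.sum_congr rfl fun j _ => ?_
  rw [Measure.smul_apply, smul_eq_mul,
    Measure.map_apply (by fun_prop) (measurableSet_singleton x)]
  congr 2
  ext y
  have := (hr j).ne'
  simp only [Set.mem_preimage, Set.mem_singleton_iff]
  rw [eq_div_iff this, eq_sub_iff_add_eq, mul_comm]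

theorem noAtoms_of_invariant [Nonempty ι] (hr : ∀ k, 0 < r k) (hp : ∀ j, 0 < p j)
    (hp1 : ∑ j, p j = 1) (hnofix : ¬ ∃ c : ℝ, ∀ k, r k * c + b k = c) [IsProbabilityMeasure ν]
    (hν : ν = ∑ j, ENNReal.ofReal (p j) • ν.map (fun x => r j * x + b j)) : NullSingletonClass ν := by
  classical
  refine ⟨fun x₀ => ?_⟩
  by_contra hx₀
  have hinv : ∀ x, ν.real {x} = ∑ j, p j * ν.real {(x - b j) / r j} := fun x => by
    rw [measureReal_def, invariant_measure_singleton hr hν x, ENNReal.toReal_sum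
      (fun j _ => ENNReal.mul_ne_top ENNReal.ofReal_ne_top (measure_ne_top _ _))]
    simp [ENNReal.toReal_mul, ENNReal.toReal_ofReal (hp _).le, measureReal_def]
  have hfin : ∀ ε : ENNReal, 0 < ε → {x : ℝ | ε ≤ ν {x}}.Finite := fun ε hε =>
    Measure.finite_const_le_meas_of_disjoint_iUnion ν hε (fun x => measurableSet_singleton x)
      (fun x y hxy => by simpa [Function.onFun] using hxy) (measure_ne_top _ _)
  have hA := hfin (ν {x₀}) (pos_iff_ne_zero.2 hx₀)
  obtain ⟨y, hyA, hy⟩ := hA.exists_maximalFor (fun x => ν {x}) _ ⟨x₀, le_refl (ν {x₀})⟩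
  have hmax : ∀ x, ν {x} ≤ ν {y} := fun x => by
    by_cases h : ν {x₀} ≤ ν {x}
    · exact not_lt.1 fun h' => absurd (hy h h'.le) (not_le.2 h')
    · exact (not_le.1 h).le.trans hyA
  have hmaxr : ∀ x, ν.real {x} ≤ ν.real {y} := fun x =>
    ENNReal.toReal_mono (measure_ne_top _ _) (hmax x)
  set E : Set ℝ := {x | ν.real {x} = ν.real {y}} with hE
  have hEfin : E.Finite := hA.subset fun x hx => by
    have : ν {x} = ν {y} := (measureReal_eq_measureReal_iff).1 hx
    exact hyA.trans_eq this.symm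
  have hmap : ∀ x ∈ E, ∀ j, (x - b j) / r j ∈ E := by
    intro x hx j
    have h1 : ∑ j, p j * ν.real {(x - b j) / r j} = ∑ j, p j * ν.real {y} := by
      rw [← hinv, ← Finset.sum_mul, hp1, one_mul]; exact hx
    have h2 := (Finset.sum_eq_sum_iff_of_le fun j _ =>
      mul_le_mul_of_nonneg_left (hmaxr _) (hp j).le).1 h1 j (Finset.mem_univ j)
    exact mul_left_cancel₀ (hp j).ne' h2
  obtain ⟨c, hcE, hc⟩ := hEfin.exists_maximalFor id _ ⟨y, rfl⟩
  have hcmax : ∀ x ∈ E, x ≤ c := fun x hx => not_lt.1 fun h => absurd (hc hx h.le) (not_le.2 h)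
  refine hnofix ⟨c, fun k => ?_⟩
  have hinj : Set.InjOn (fun x => (x - b k) / r k) E := fun x _ x' _ h => by
    have := (hr k).ne'
    simpa [div_left_inj' this] using h
  have hsurj : Set.SurjOn (fun x => (x - b k) / r k) E E :=
    ((hEfin.injOn_iff_bijOn_of_mapsTo (fun x hx => hmap x hx k)).1 hinj).surjOn
  obtain ⟨e, heE, he⟩ := hsurj hcE
  have h1 := hcmax _ (hmap c hcE k)
  have h2 := hcmax e heE
  simp only at he
  have h3 : (e - b k) / r k ≤ (c - b k) / r k := by
    have := hr k; gcongr
  rw [he] at h3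
  have h4 := le_antisymm h1 h3
  rw [div_eq_iff (hr k).ne'] at h4
  linarith

theorem charFun_invariant (hp : ∀ j, 0 < p j) [IsProbabilityMeasure ν]
    (hν : ν = ∑ j, ENNReal.ofReal (p j) • ν.map (fun x => r j * x + b j)) (t : ℝ) :
    charFun ν t = ∑ j, (p j : ℂ) * (charFun ν (r j * t) * Complex.exp (t * b j * Complex.I)) := by
  have hprob : ∀ j, IsProbabilityMeasure (ν.map fun x => r j * x + b j) := fun j =>
    Measure.isProbabilityMeasure_map (by fun_prop)
  have hmap : ∀ j, charFun (ν.map fun x => r j * x + b j) t =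
      charFun ν (r j * t) * Complex.exp (t * b j * Complex.I) := fun j => by
    rw [show (fun x => r j * x + b j) = (· + b j) ∘ (r j * ·) from rfl,
      ← Measure.map_map (by fun_prop) (by fun_prop), charFun_map_add_const, charFun_map_mul]
    simp
  conv_lhs => rw [hν]
  rw [charFun_apply, integral_finsetSum_measure fun j _ => ?_]
  · refine Finset.sum_congr rfl fun j _ => ?_
    rw [integral_smul_measure, ENNReal.toReal_ofReal (hp j).le, ← charFun_apply, hmap,
      Complex.real_smul]
  · refine Integrable.smul_measure ?_ ENNReal.ofReal_ne_top
    refine (integrable_const (1 : ℝ)).mono (by fun_prop) (ae_of_all _ fun x => ?_)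
    simpa using (Complex.norm_exp_ofReal_mul_I (t * x)).le

end Invariant

/-- If `log (r i) / log (r j)` is irrational for some pair `i ≠ j`,
then the invariant measure `ν` of the affine IFS `φ k x = r k * x + b k` (no common
fixed point, contracting on average, `p ∈ C_N`) is Rajchman. -/
theorem stmt5 {N : ℕ} (hN : 1 ≤ N) (r b p : Fin (N + 1) → ℝ)
    (hr : ∀ k, 0 < r k) (hp : ∀ j, 0 < p j) (hp1 : ∑ j, p j = 1)
    (hnofix : ¬ ∃ c : ℝ, ∀ k, r k * c + b k = c)
    (hcontr : ∑ j, p j * Real.log (r j) < 0)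
    (ν : Measure ℝ) [IsProbabilityMeasure ν]
    (hν : ν = ∑ j, ENNReal.ofReal (p j) • ν.map (fun x => r j * x + b j))
    (hirr : ∃ i j : Fin (N + 1), i ≠ j ∧ Irrational (Real.log (r i) / Real.log (r j))) :
    Tendsto (FT ν) atTop (nhds 0) := by
  obtain ⟨i, j, -, hij⟩ := hirr
  have := noAtoms_of_invariant hr hp hp1 hnofix hν
  have hle : ∀ t, ‖charFun ν t‖ ≤ ∑ j, p j * ‖charFun ν (r j * t)‖ := fun t => by
    rw [charFun_invariant hp hν t]
    refine (norm_sum_le _ _).trans_eq (Finset.sum_congr rfl fun j _ => ?_)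
    rw [norm_mul, norm_mul, ← Complex.ofReal_mul, Complex.norm_exp_ofReal_mul_I, mul_one,
      Complex.norm_real, Real.norm_of_nonneg (hp j).le]
  have hw := tendsto_zero_of_subharmonic (ℓ := fun k => Real.log (r k))
    (w := fun s => ‖charFun ν (Real.exp s)‖ ^ 2) hp hp1 hcontr hij (by fun_prop)
    (fun s => by positivity) (fun s => pow_le_one₀ (norm_nonneg _) (norm_charFun_le_one _))
    (fun s => ?_) fun D hD => tendsto_integral_norm_charFun_exp_sq ν hD
  · have hnorm : Tendsto (fun t => ‖charFun ν t‖) atTop (nhds 0) := by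
      have h1 := (hw.comp Real.tendsto_log_atTop).sqrt
      rw [Real.sqrt_zero] at h1
      refine h1.congr' ?_
      filter_upwards [eventually_gt_atTop 0] with t ht
      simp only [Function.comp_apply]
      rw [Real.exp_log ht, Real.sqrt_sq (norm_nonneg _)]
    have hFT : FT ν = fun t => charFun ν (2 * Real.pi * t) := by
      ext t
      rw [FT, charFun_apply_real]
      refine integral_congr_ae (ae_of_all _ fun x => ?_)
      push_cast
      ring_nf
    rw [hFT]
    exact (tendsto_zero_iff_norm_tendsto_zero.2 hnorm).comp
      (tendsto_id.const_mul_atTop (by positivity))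
  · rw [walkOp_apply]
    refine (pow_le_pow_left₀ (norm_nonneg _) (hle _) 2).trans ?_
    have h := (convexOn_pow 2).map_sum_le (t := Finset.univ) (w := p)
      (p := fun k => ‖charFun ν (r k * Real.exp s)‖) (fun k _ => (hp k).le) hp1
      (fun k _ => norm_nonneg _)
    simp only [smul_eq_mul] at h
    refine h.trans_eq (Finset.sum_congr rfl fun k _ => ?_)
    rw [Real.exp_add, Real.exp_log (hr k), mul_comm (r k)]
end
end

section
/- Let 1/λ > 1 be the Plastic number, i.e. the unique real root of X³ − X − 1 (a Pisot number), and consider the two affine contractions φ_0(x) = λ² x and φ_1(x) = λ³ x + 1. For a probability vector p = (p_0, p_1) with p_0 > 0, p_1 > 0, p_0 + p_1 = 1, let ν be the invariant measure. Then: (a) if p = (λ², λ³), then ν = (1/(1+λ))·(Lebesgue measure restricted to [0, 1+λ]); (b) if p ≠ (λ², λ³), then ν is continuous (non-atomic), singular with respect to Lebesgue measure on ℝ, and not Rajchman. -/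
open MeasureTheory Filter Finset

noncomputable section

/-- A measure on `ℝ` is Rajchman if its Fourier transform tends to `0` at `+∞`. -/
def Rajchman (μ : Measure ℝ) : Prop :=
  Tendsto (FT μ) atTop (nhds 0)

/-- The Perrin sequence, i.e. the traces of the powers of the Plastic number. -/
def perrin : ℕ → ℤ
  | 0 => 3
  | 1 => 0
  | 2 => 2
  | (n + 3) => perrin (n + 1) + perrin n

lemma sq_add_cube_eq_one {l : ℝ} (hl0 : 0 < l) (h : l⁻¹ ^ 3 = l⁻¹ + 1) : l ^ 2 + l ^ 3 = 1 := by
  have := hl0.ne'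
  field_simp at h
  linarith

lemma inv_sq_eq {l : ℝ} (hl0 : 0 < l) (h : l ^ 2 + l ^ 3 = 1) : l⁻¹ ^ 2 = 1 + l := by
  field_simp
  linarith

lemma perrin_quadratic {l : ℝ} (hl0 : 0 < l) (h : l ^ 2 + l ^ 3 = 1) (n : ℕ) :
    (l⁻¹ ^ (n + 2) - perrin (n + 2)) + l⁻¹ * (l⁻¹ ^ (n + 1) - perrin (n + 1))
      + l * (l⁻¹ ^ n - perrin n) = 0 := by
  have h2 := inv_sq_eq hl0 h
  have h1 : l⁻¹ * l = 1 := inv_mul_cancel₀ hl0.ne'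
  set a := l⁻¹
  induction n with
  | zero =>
    simp only [perrin]
    push_cast
    linear_combination 2 * h2
  | succ n ih =>
    have e : perrin (n + 1 + 2) = perrin (n + 1) + perrin n := rfl
    rw [e, show n + 1 + 1 = n + 2 from rfl]
    push_cast
    linear_combination a * ih + perrin (n + 1) * h2 + perrin n * h1

lemma exists_abs_inv_pow_sub_int_le {l : ℝ} (hl0 : 0 < l) (hl1 : l < 1) (h : l ^ 2 + l ^ 3 = 1) :
    ∃ C : ℝ, 0 < C ∧ ∀ n : ℕ, ∃ N : ℤ, |l⁻¹ ^ n - N| ≤ C * √l ^ n := by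
  have h1 : l⁻¹ * l = 1 := inv_mul_cancel₀ hl0.ne'
  have h2 := inv_sq_eq hl0 h
  have hl7 : 7 / 10 < l := by
    by_contra! hc
    nlinarith [mul_nonneg hl0.le hl0.le, mul_nonneg (mul_nonneg hl0.le hl0.le) (sub_nonneg.2 hc),
      mul_nonneg hl0.le (sub_nonneg.2 hc)]
  set u : ℕ → ℝ := fun n => l⁻¹ ^ n - perrin n with hu
  have hrec : ∀ n, u (n + 2) = -l⁻¹ * u (n + 1) - l * u n := fun n => by
    have := perrin_quadratic hl0 h n
    simp only [hu]
    linarith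
  set Q : ℕ → ℝ := fun n => u (n + 1) ^ 2 + l⁻¹ * u (n + 1) * u n + l * u n ^ 2 with hQ
  have hQn : ∀ n, Q n = l ^ n * Q 0 := by
    intro n
    induction n with
    | zero => simp
    | succ n ih =>
      have : Q (n + 1) = l * Q n := by
        simp only [hQ, show n + 1 + 1 = n + 2 from rfl, hrec n]
        ring
      rw [this, ih]
      ring
  have hbd : ∀ n, u n ^ 2 ≤ 4 * Q n := by
    intro n
    have e : Q n = (u (n + 1) + l⁻¹ / 2 * u n) ^ 2 + (l - (1 + l) / 4) * u n ^ 2 := by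
      rw [← h2]; simp only [hQ]; ring
    rw [e]
    nlinarith [sq_nonneg (u (n + 1) + l⁻¹ / 2 * u n), sq_nonneg (u n),
      mul_nonneg (sub_nonneg.2 hl7.le) (sq_nonneg (u n))]
  refine ⟨√(4 * Q 0) + 1, by positivity, fun n => ⟨perrin n, ?_⟩⟩
  have : |u n| ≤ √(4 * Q 0) * √l ^ n := by
    rw [← Real.sqrt_sq_eq_abs]
    calc √(u n ^ 2) ≤ √(l ^ n * (4 * Q 0)) := by
          apply Real.sqrt_le_sqrt
          rw [show l ^ n * (4 * Q 0) = 4 * (l ^ n * Q 0) by ring, ← hQn]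
          exact hbd n
      _ = _ := by
          rw [Real.sqrt_mul (by positivity), mul_comm]
          congr 1
          rw [Real.sqrt_eq_iff_mul_self_eq (by positivity) (by positivity), ← mul_pow,
            Real.mul_self_sqrt hl0.le]
  refine this.trans ?_
  have : 0 ≤ √l ^ n := by positivity
  nlinarith

lemma int_linear_independent {l : ℝ} (h : l⁻¹ ^ 3 = l⁻¹ + 1) (a b c : ℤ)
    (habc : a + b * l⁻¹ + c * l⁻¹ ^ 2 = 0) : a = 0 ∧ b = 0 ∧ c = 0 := by
  open Polynomial in
  have hmin : (X ^ 3 - X - 1 : ℚ[X]) = minpoly ℚ l⁻¹ := by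
    apply minpoly.eq_of_irreducible_of_monic
    · exact X_pow_sub_X_sub_one_irreducible_rat (by norm_num)
    · simp only [map_sub, map_pow, aeval_X, map_one]
      linarith
    · monicity!
  by_contra hne
  set P : ℚ[X] := C (c : ℚ) * X ^ 2 + C (b : ℚ) * X + C (a : ℚ) with hP
  have hP0 : P ≠ 0 := by
    intro h0
    apply hne
    have e0 := congrArg (fun p => coeff p 0) h0
    have e1 := congrArg (fun p => coeff p 1) h0
    have e2 := congrArg (fun p => coeff p 2) h0
    simp [hP, coeff_X, coeff_C, -map_intCast] at e0 e1 e2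
    exact ⟨e0, e1, e2⟩
  have := minpoly.degree_le_of_ne_zero ℚ l⁻¹ hP0 (by
    simp only [hP, map_add, map_mul, aeval_X, map_pow, aeval_C]
    simpa [add_comm, add_left_comm, add_assoc] using habc)
  rw [← hmin] at this
  have d1 : (X ^ 3 - X - 1 : ℚ[X]).degree = 3 := by compute_degree!
  have d2 : P.degree ≤ 2 := degree_quadratic_le
  rw [d1] at this
  exact absurd (this.trans d2) (by decide)

/-- `ν` is invariant under the weighted system `x ↦ l² x`, `x ↦ l³ x + 1`. -/
def PlasticInvariant (l p₀ p₁ : ℝ) (ν : Measure ℝ) : Prop :=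
  ν = ENNReal.ofReal p₀ • ν.map (fun x => l ^ 2 * x) +
    ENNReal.ofReal p₁ • ν.map (fun x => l ^ 3 * x + 1)

lemma PlasticInvariant.add_le {l p₀ p₁ : ℝ} {ν : Measure ℝ} [IsFiniteMeasure ν] (hp0 : 0 ≤ p₀)
    (hp1 : 0 ≤ p₁) (hν : PlasticInvariant l p₀ p₁ ν) (s : Set ℝ) :
    p₀ * ν.real ((fun x => l ^ 2 * x) ⁻¹' s) + p₁ * ν.real ((fun x => l ^ 3 * x + 1) ⁻¹' s)
      ≤ ν.real s := by
  have h : ENNReal.ofReal p₀ * ν ((fun x => l ^ 2 * x) ⁻¹' s) +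
      ENNReal.ofReal p₁ * ν ((fun x => l ^ 3 * x + 1) ⁻¹' s) ≤ ν s := by
    conv_rhs => rw [hν]
    simp only [Measure.add_apply, Measure.smul_apply, smul_eq_mul]
    exact add_le_add (mul_le_mul' le_rfl (Measure.le_map_apply (by fun_prop) s))
      (mul_le_mul' le_rfl (Measure.le_map_apply (by fun_prop) s))
  have := ENNReal.toReal_mono (measure_ne_top ν s) h
  rwa [ENNReal.toReal_add (ENNReal.mul_ne_top (by simp) (measure_ne_top _ _))
    (ENNReal.mul_ne_top (by simp) (measure_ne_top _ _)), ENNReal.toReal_mul, ENNReal.toReal_mul,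
    ENNReal.toReal_ofReal hp0, ENNReal.toReal_ofReal hp1] at this

/-- Points whose dilation by `l⁻¹ ^ (n + q)` agrees modulo `1`, up to a small error, with the
dilation by `l⁻¹ ^ q` of a point of `Z`, for all `q`. -/
def trackedSet (l C : ℝ) (Z : Set ℝ) (n : ℕ) : Set ℝ :=
  {x | ∃ z ∈ Z, ∀ q : ℕ, ∃ N : ℤ,
    |l⁻¹ ^ (n + q) * x - l⁻¹ ^ q * z - N| ≤ C * √l ^ q * ∑ j ∈ range (n + 1), √l ^ j}

lemma trackedSet_step_zero {l C : ℝ} (hl0 : 0 < l) (hC : 0 < C) (Z : Set ℝ) (n : ℕ) :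
    trackedSet l C Z n ⊆ (fun x => l ^ 2 * x) ⁻¹' trackedSet l C Z (n + 2) := by
  rintro x ⟨z, hz, hx⟩
  refine ⟨z, hz, fun q => ?_⟩
  obtain ⟨N, hN⟩ := hx q
  refine ⟨N, ?_⟩
  have e : l⁻¹ ^ (n + 2 + q) * (l ^ 2 * x) = l⁻¹ ^ (n + q) * x := by
    rw [show n + 2 + q = n + q + 2 by ring, pow_add]
    field_simp
  dsimp only
  rw [e]
  refine hN.trans ?_
  gcongr
  omega

lemma trackedSet_step_one {l C : ℝ} (hl0 : 0 < l) (hC : 0 < C)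
    (happrox : ∀ n : ℕ, ∃ N : ℤ, |l⁻¹ ^ n - N| ≤ C * √l ^ n) (Z : Set ℝ) (n : ℕ) :
    trackedSet l C Z n ⊆ (fun x => l ^ 3 * x + 1) ⁻¹' trackedSet l C Z (n + 3) := by
  rintro x ⟨z, hz, hx⟩
  refine ⟨z, hz, fun q => ?_⟩
  obtain ⟨N, hN⟩ := hx q
  obtain ⟨M, hM⟩ := happrox (n + 3 + q)
  refine ⟨N + M, ?_⟩
  have e : l⁻¹ ^ (n + 3 + q) * (l ^ 3 * x + 1) = l⁻¹ ^ (n + q) * x + l⁻¹ ^ (n + 3 + q) := by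
    rw [show n + 3 + q = n + q + 3 by ring, pow_add]
    field_simp
  dsimp only
  rw [e]
  push_cast
  calc _ = |(l⁻¹ ^ (n + q) * x - l⁻¹ ^ q * z - N) + (l⁻¹ ^ (n + 3 + q) - M)| := by
        congr 1; ring
    _ ≤ _ := (abs_add_le _ _).trans (add_le_add hN hM)
    _ = C * √l ^ q * (∑ j ∈ range (n + 1), √l ^ j + √l ^ (n + 3)) := by ring
    _ ≤ _ := by
        gcongr
        rw [sum_range_succ _ (n + 3), sum_range_succ _ (n + 2), sum_range_succ _ (n + 1)]
        have h1 : 0 ≤ √l ^ (n + 1) := by positivity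
        have h2 : 0 ≤ √l ^ (n + 2) := by positivity
        linarith

lemma le_measureReal_trackedSet {l C p₀ p₁ : ℝ} {ν : Measure ℝ} [IsFiniteMeasure ν]
    (hl0 : 0 < l) (hC : 0 < C) (happrox : ∀ n : ℕ, ∃ N : ℤ, |l⁻¹ ^ n - N| ≤ C * √l ^ n)
    (hp0 : 0 < p₀) (hp1 : 0 < p₁) (hsum : p₀ + p₁ = 1) (hν : PlasticInvariant l p₀ p₁ ν)
    (Z : Set ℝ) (n : ℕ) :
    p₀ ^ 2 * p₁ * ν.real Z ≤ ν.real (trackedSet l C Z (n + 2)) := by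
  have step0 : ∀ n, p₀ * ν.real (trackedSet l C Z n) ≤ ν.real (trackedSet l C Z (n + 2)) := by
    intro n
    refine le_trans ?_ (hν.add_le hp0.le hp1.le _)
    have : 0 ≤ p₁ * ν.real ((fun x => l ^ 3 * x + 1) ⁻¹' trackedSet l C Z (n + 2)) := by
      positivity
    have := measureReal_mono (μ := ν) (trackedSet_step_zero hl0 hC Z n)
    nlinarith
  have step : ∀ n, p₀ * ν.real (trackedSet l C Z (n + 1)) + p₁ * ν.real (trackedSet l C Z n)
      ≤ ν.real (trackedSet l C Z (n + 3)) := by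
    intro n
    refine le_trans ?_ (hν.add_le hp0.le hp1.le _)
    have h0 := measureReal_mono (μ := ν) (trackedSet_step_zero hl0 hC Z (n + 1))
    have h1 := measureReal_mono (μ := ν) (trackedSet_step_one hl0 hC happrox Z n)
    gcongr
  have hZ : ν.real Z ≤ ν.real (trackedSet l C Z 0) := by
    refine measureReal_mono fun z hz => ⟨z, hz, fun q => ⟨0, ?_⟩⟩
    simp
    positivity
  have hz : 0 ≤ ν.real Z := measureReal_nonneg
  have hp0' : p₀ ≤ 1 := by linarith
  have hp1' : p₁ ≤ 1 := by linarith
  have hp00 : p₀ ^ 2 ≤ 1 := by nlinarith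
  set κ := p₀ ^ 2 * p₁ * ν.real Z
  have key : ∀ n, κ ≤ ν.real (trackedSet l C Z (n + 2)) ∧
      κ ≤ ν.real (trackedSet l C Z (n + 3)) ∧ κ ≤ ν.real (trackedSet l C Z (n + 4)) := by
    intro n
    induction n with
    | zero =>
      have a2 := step0 0
      have a4 := step0 2
      have a3 := step 0
      have b2 : p₀ * ν.real Z ≤ ν.real (trackedSet l C Z (0 + 2)) := by nlinarith
      have b4 : p₀ * (p₀ * ν.real Z) ≤ ν.real (trackedSet l C Z (0 + 4)) := by
        refine le_trans ?_ a4
        gcongr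
      have b3 : p₁ * ν.real Z ≤ ν.real (trackedSet l C Z (0 + 3)) := by
        have : 0 ≤ p₀ * ν.real (trackedSet l C Z (0 + 1)) := by positivity
        nlinarith
      refine ⟨le_trans ?_ b2, le_trans ?_ b3, le_trans ?_ b4⟩
      · have : p₀ * p₁ ≤ 1 := by nlinarith
        calc κ = (p₀ * p₁) * (p₀ * ν.real Z) := by ring
          _ ≤ 1 * (p₀ * ν.real Z) := by gcongr
          _ = _ := one_mul _
      · calc κ = p₀ ^ 2 * (p₁ * ν.real Z) := by ring
          _ ≤ 1 * (p₁ * ν.real Z) := by gcongr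
          _ = _ := one_mul _
      · calc κ = p₁ * (p₀ * (p₀ * ν.real Z)) := by ring
          _ ≤ 1 * (p₀ * (p₀ * ν.real Z)) := by gcongr
          _ = _ := one_mul _
    | succ n ih =>
      refine ⟨ih.2.1, ih.2.2, le_trans ?_ (step (n + 2))⟩
      calc κ = p₀ * κ + p₁ * κ := by rw [← add_mul, hsum, one_mul]
        _ ≤ _ := add_le_add (mul_le_mul_of_nonneg_left ih.2.1 hp0.le)
          (mul_le_mul_of_nonneg_left ih.1 hp1.le)
  exact (key n).1

/-- If one branch has the form `x ↦ l ^ k * x + d`, then iterating it gives neighbourhoods of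
its orbit with controlled mass. -/
lemma exists_center_measureReal_ge {l p d : ℝ} {k : ℕ} {ν : Measure ℝ} [IsFiniteMeasure ν]
    (hl0 : 0 < l) (hp : 0 ≤ p)
    (hstep : ∀ s : Set ℝ, p * ν.real ((fun x => l ^ k * x + d) ⁻¹' s) ≤ ν.real s)
    (R : ℝ) (m : ℕ) :
    ∃ c : ℝ, p ^ m * ν.real (Set.Icc (-R) R) ≤ ν.real {z | |z - c| ≤ R * l ^ (k * m)} := by
  induction m with
  | zero =>
    refine ⟨0, ?_⟩
    simp only [pow_zero, one_mul, mul_zero, mul_one, sub_zero, abs_le]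
    rfl
  | succ m ih =>
    obtain ⟨c, hc⟩ := ih
    refine ⟨l ^ k * c + d, le_trans ?_ (hstep _)⟩
    rw [pow_succ', mul_assoc]
    refine mul_le_mul_of_nonneg_left (hc.trans (measureReal_mono fun z hz => ?_)) hp
    simp only [Set.mem_preimage, Set.mem_ofPred_eq] at hz ⊢
    rw [show l ^ k * z + d - (l ^ k * c + d) = l ^ k * (z - c) by ring, abs_mul,
      abs_of_pos (by positivity), mul_add, pow_add]
    calc l ^ k * |z - c| ≤ l ^ k * (R * l ^ (k * m)) := by gcongr
      _ = _ := by ring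

lemma FT_neg (μ : Measure ℝ) (t : ℝ) : FT μ (-t) = starRingEnd ℂ (FT μ t) := by
  unfold FT
  rw [← integral_conj]
  congr 1 with x
  rw [← Complex.exp_conj]
  simp [Complex.conj_ofNat]

lemma FT_zero (μ : Measure ℝ) [IsProbabilityMeasure μ] : FT μ 0 = 1 := by
  simp [FT]

lemma Rajchman.tendsto_const_mul {μ : Measure ℝ} (hμ : Rajchman μ) {a : ℝ} (ha : a ≠ 0)
    {T : ℕ → ℝ} (hT : Tendsto T atTop atTop) :
    Tendsto (fun n => FT μ (a * T n)) atTop (nhds 0) := by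
  rcases ha.lt_or_gt with ha | ha
  · have h1 : Tendsto (fun n => -a * T n) atTop atTop := hT.const_mul_atTop (by linarith)
    have h2 := (Complex.continuous_conj.tendsto 0).comp (hμ.comp h1)
    simp only [map_zero] at h2
    refine h2.congr fun n => ?_
    simp only [Function.comp]
    rw [← FT_neg]
    congr 1
    ring
  · exact hμ.comp (hT.const_mul_atTop ha)

lemma integrable_const_mul_exp (μ : Measure ℝ) [IsFiniteMeasure μ] (c : ℂ) (t : ℝ) :
    Integrable (fun x : ℝ => c * Complex.exp (2 * (Real.pi : ℂ) * Complex.I * (t : ℂ) * x)) μ := by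
  refine Integrable.of_bound (by fun_prop) ‖c‖ (.of_forall fun x => ?_)
  rw [norm_mul, show 2 * (Real.pi : ℂ) * Complex.I * (t : ℂ) * x
    = ((2 * Real.pi * t * x : ℝ) : ℂ) * Complex.I by push_cast; ring,
    Complex.norm_exp_ofReal_mul_I, mul_one]

/-- A trigonometric sum with coefficients `c` and frequencies `t`. -/
def trigSum {ι : Type*} (S : Finset ι) (c : ι → ℂ) (t : ι → ℝ) (x : ℝ) : ℂ :=
  ∑ s ∈ S, c s * Complex.exp (2 * (Real.pi : ℂ) * Complex.I * (t s : ℂ) * x)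

lemma norm_sq_trigSum {ι : Type*} (S : Finset ι) (c : ι → ℂ) (t : ι → ℝ) (x : ℝ) :
    ((‖trigSum S c t x‖ ^ 2 : ℝ) : ℂ) = ∑ s ∈ S, ∑ r ∈ S, starRingEnd ℂ (c s) * c r *
      Complex.exp (2 * (Real.pi : ℂ) * Complex.I * ((t r - t s : ℝ) : ℂ) * x) := by
  push_cast
  rw [← Complex.conj_mul', trigSum, map_sum, sum_mul_sum]
  refine sum_congr rfl fun s _ => sum_congr rfl fun r _ => ?_
  rw [map_mul, ← Complex.exp_conj]
  rw [show ∀ a b d e : ℂ, a * b * (d * e) = a * d * (b * e) by intros; ring, ← Complex.exp_add]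
  congr 2
  simp [Complex.conj_ofNat]
  ring

lemma integral_norm_sq_trigSum {ι : Type*} (μ : Measure ℝ) [IsFiniteMeasure μ]
    (S : Finset ι) (c : ι → ℂ) (t : ι → ℝ) :
    ((∫ x, ‖trigSum S c t x‖ ^ 2 ∂μ : ℝ) : ℂ)
      = ∑ s ∈ S, ∑ r ∈ S, starRingEnd ℂ (c s) * c r * FT μ (t r - t s) := by
  rw [← integral_complex_ofReal]
  simp_rw [norm_sq_trigSum]
  rw [integral_finsetSum _ fun s _ => integrable_finsetSum _ fun r _ =>
    integrable_const_mul_exp μ _ _]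
  refine sum_congr rfl fun s _ => ?_
  rw [integral_finsetSum _ fun r _ => integrable_const_mul_exp μ _ _]
  refine sum_congr rfl fun r _ => ?_
  rw [integral_const_mul]
  rfl

lemma Rajchman.tendsto_integral_norm_sq {ι : Type*} {μ : Measure ℝ} [IsProbabilityMeasure μ]
    (hμ : Rajchman μ) (S : Finset ι) (c : ι → ℂ) (hc : ∀ s ∈ S, ‖c s‖ = 1) (a : ι → ℝ)
    (ha : Set.InjOn a S) {T : ℕ → ℝ} (hT : Tendsto T atTop atTop) :
    Tendsto (fun n => ∫ x, ‖trigSum S c (fun s => a s * T n) x‖ ^ 2 ∂μ) atTop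
      (nhds (#S : ℝ)) := by
  classical
  rw [Complex.isUniformEmbedding_ofReal.isEmbedding.tendsto_nhds_iff]
  simp only [Function.comp_def, integral_norm_sq_trigSum]
  have : ((#S : ℝ) : ℂ) = ∑ s ∈ S, ∑ r ∈ S, if s = r then 1 else 0 := by
    simp
  rw [this]
  refine tendsto_finsetSum _ fun s hs => tendsto_finsetSum _ fun r hr => ?_
  split_ifs with h
  · subst h
    simp only [sub_self, FT_zero, mul_one, Complex.conj_mul', hc s hs]
    simp
  · have h1 : a r - a s ≠ 0 := sub_ne_zero.2 fun h2 => h (ha hs hr h2.symm)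
    have := (hμ.tendsto_const_mul h1 hT).const_mul (starRingEnd ℂ (c s) * c r)
    rw [mul_zero] at this
    refine this.congr fun n => ?_
    rw [sub_mul]

lemma half_le_re_exp {θ : ℝ} {N : ℤ} (h : |θ - N| ≤ 1 / 8) :
    1 / 2 ≤ (Complex.exp (2 * (Real.pi : ℂ) * Complex.I * θ)).re := by
  have e : 2 * (Real.pi : ℂ) * Complex.I * θ
      = ((2 * Real.pi * (θ - N) : ℝ) : ℂ) * Complex.I + N * (2 * Real.pi * Complex.I) := by
    push_cast; ring
  rw [e, Complex.exp_add, Complex.exp_int_mul_two_pi_mul_I, mul_one,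
    Complex.exp_ofReal_mul_I_re]
  refine le_trans ?_ Real.one_sub_sq_div_two_le_cos
  have h1 : (θ - N) ^ 2 ≤ (1 / 8) ^ 2 := sq_le_sq' (by linarith [abs_le.1 h]) (abs_le.1 h).2
  have h2 : Real.pi ^ 2 ≤ 4 ^ 2 := by gcongr; exact Real.pi_le_four
  nlinarith [sq_nonneg (θ - N), sq_nonneg Real.pi]

lemma half_card_le_norm_trigSum {ι : Type*} (S : Finset ι) (b t : ι → ℝ) (x : ℝ)
    (h : ∀ s ∈ S, ∃ N : ℤ, |t s * x + b s - N| ≤ 1 / 8) :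
    (#S : ℝ) / 2 ≤
      ‖trigSum S (fun s => Complex.exp (2 * (Real.pi : ℂ) * Complex.I * b s)) t x‖ := by
  refine le_trans ?_ (Complex.re_le_norm _)
  rw [trigSum, Complex.re_sum]
  calc (#S : ℝ) / 2 = ∑ s ∈ S, (1 / 2 : ℝ) := by simp; ring
    _ ≤ _ := sum_le_sum fun s hs => ?_
  obtain ⟨N, hN⟩ := h s hs
  refine (half_le_re_exp hN).trans (le_of_eq ?_)
  rw [← Complex.exp_add]
  congr 2
  push_cast
  ring

/-- For a Rajchman measure, a set of positive mass cannot correlate with many frequencies. -/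
lemma Rajchman.mul_card_le {ι : Type*} {μ : Measure ℝ} [IsProbabilityMeasure μ]
    (hμ : Rajchman μ) (S : Finset ι) (b a : ι → ℝ) (ha : Set.InjOn a S)
    {T : ℕ → ℝ} (hT : Tendsto T atTop atTop) {κ : ℝ} (E : ℕ → Set ℝ)
    (hκ : ∀ n, κ ≤ μ.real (E n))
    (hE : ∀ n, ∀ x ∈ E n, ∀ s ∈ S, ∃ N : ℤ, |a s * T n * x + b s - N| ≤ 1 / 8) :
    κ * #S ≤ 4 := by
  set c : ι → ℂ := fun s => Complex.exp (2 * (Real.pi : ℂ) * Complex.I * b s) with hcdef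
  have hc : ∀ s ∈ S, ‖c s‖ = 1 := fun s _ => by
    simp only [hcdef]
    rw [show 2 * (Real.pi : ℂ) * Complex.I * b s = ((2 * Real.pi * b s : ℝ) : ℂ) * Complex.I by
      push_cast; ring, Complex.norm_exp_ofReal_mul_I]
  have hlim := hμ.tendsto_integral_norm_sq S c hc a ha hT
  have hle : ∀ n, (#S / 2 : ℝ) ^ 2 * κ ≤ ∫ x, ‖trigSum S c (fun s => a s * T n) x‖ ^ 2 ∂μ := by
    intro n
    have hcont : Continuous fun x => ‖trigSum S c (fun s => a s * T n) x‖ ^ 2 := by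
      unfold trigSum
      fun_prop
    have hint : Integrable (fun x => ‖trigSum S c (fun s => a s * T n) x‖ ^ 2) μ := by
      refine Integrable.of_bound hcont.aestronglyMeasurable ((#S : ℝ) ^ 2) (.of_forall fun x => ?_)
      rw [norm_pow, norm_norm]
      gcongr
      refine (norm_sum_le _ _).trans ?_
      rw [card_eq_sum_ones, Nat.cast_sum]
      refine sum_le_sum fun s hs => ?_
      rw [norm_mul, hc s hs, show 2 * (Real.pi : ℂ) * Complex.I * ((a s * T n : ℝ) : ℂ) * x
        = ((2 * Real.pi * (a s * T n) * x : ℝ) : ℂ) * Complex.I by push_cast; ring,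
        Complex.norm_exp_ofReal_mul_I]
      simp
    refine le_trans ?_ (mul_meas_ge_le_integral_of_nonneg (.of_forall fun x => by positivity) hint
      ((#S / 2 : ℝ) ^ 2))
    gcongr
    refine (hκ n).trans (measureReal_mono fun x hx => ?_)
    simp only [Set.mem_ofPred_eq]
    gcongr
    exact half_card_le_norm_trigSum S b _ x (hE n x hx)
  have := ge_of_tendsto' hlim hle
  rcases S.eq_empty_or_nonempty with h | h
  · simp [h]
  · have : (0 : ℝ) < #S := by exact_mod_cast h.card_pos
    nlinarith

lemma geom_sum_le_inv {r : ℝ} (h0 : 0 ≤ r) (h1 : r < 1) (n : ℕ) :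
    ∑ j ∈ range n, r ^ j ≤ (1 - r)⁻¹ := by
  rw [← tsum_geometric_of_lt_one h0 h1]
  exact (summable_geometric_of_lt_one h0 h1).sum_le_tsum _ fun i _ => by positivity

lemma exists_int_near_of_mem_trackedSet {l C R : ℝ} (hl0 : 0 < l) (hl1 : l < 1) (hC : 0 < C)
    (hR : 0 ≤ R) :
    ∃ D : ℝ, 0 < D ∧ ∀ (m n : ℕ) (c x : ℝ),
      x ∈ trackedSet l C {z | |z - c| ≤ R * l ^ (3 * m)} n → ∀ i ≤ 2, ∃ N : ℤ,
        |l⁻¹ ^ (n + (2 * m + i)) * x - l⁻¹ ^ (2 * m + i) * c - N| ≤ D * l ^ m := by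
  have hs1 : √l < 1 := by rw [Real.sqrt_lt' one_pos]; linarith
  have hs0 : 0 ≤ √l := Real.sqrt_nonneg l
  have hinv : 1 ≤ l⁻¹ := (one_le_inv₀ hl0).2 hl1.le
  refine ⟨C * (1 - √l)⁻¹ + l⁻¹ ^ 2 * R, by
    have : 0 < (1 - √l)⁻¹ := inv_pos.2 (by linarith)
    positivity, ?_⟩
  rintro m n c x ⟨z, hz, hx⟩ i hi
  obtain ⟨N, hN⟩ := hx (2 * m + i)
  refine ⟨N, ?_⟩
  have e1 : √l ^ (2 * m + i) ≤ l ^ m := by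
    rw [pow_add, pow_mul, Real.sq_sqrt hl0.le]
    exact mul_le_of_le_one_right (by positivity) (pow_le_one₀ hs0 hs1.le)
  have e2 : l⁻¹ ^ (2 * m + i) * |z - c| ≤ l⁻¹ ^ 2 * R * l ^ m := by
    calc l⁻¹ ^ (2 * m + i) * |z - c| ≤ l⁻¹ ^ (2 * m + i) * (R * l ^ (3 * m)) := by
          gcongr; exact hz
      _ = l⁻¹ ^ i * R * l ^ m := by
          have hcancel : l⁻¹ ^ (2 * m) * l ^ (2 * m) = 1 := by
            rw [← mul_pow, inv_mul_cancel₀ hl0.ne', one_pow]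
          rw [show 3 * m = 2 * m + m by ring, pow_add, pow_add]
          linear_combination (l⁻¹ ^ i * R * l ^ m) * hcancel
      _ ≤ _ := by gcongr
  calc _ = |(l⁻¹ ^ (n + (2 * m + i)) * x - l⁻¹ ^ (2 * m + i) * z - N)
          + l⁻¹ ^ (2 * m + i) * (z - c)| := by congr 1; ring
    _ ≤ C * √l ^ (2 * m + i) * ∑ j ∈ range (n + 1), √l ^ j + l⁻¹ ^ (2 * m + i) * |z - c| := by
        refine (abs_add_le _ _).trans (add_le_add hN ?_)
        rw [abs_mul, abs_of_pos (by positivity)]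
    _ ≤ C * l ^ m * (1 - √l)⁻¹ + l⁻¹ ^ 2 * R * l ^ m := by
        gcongr
        exact geom_sum_le_inv hs0 hs1 _
    _ = _ := by ring

lemma exists_half_le_measureReal_Icc (ν : Measure ℝ) [IsProbabilityMeasure ν] :
    ∃ R : ℝ, 0 ≤ R ∧ 1 / 2 ≤ ν.real (Set.Icc (-R) R) := by
  have hmono : Monotone fun n : ℕ => Set.Icc (-(n : ℝ)) n := fun m n hmn => by
    have : (m : ℝ) ≤ n := by exact_mod_cast hmn
    exact Set.Icc_subset_Icc (by linarith) this
  have h := tendsto_measure_iUnion_atTop (μ := ν) hmono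
  have hU : (⋃ n : ℕ, Set.Icc (-(n : ℝ)) n) = Set.univ := by
    refine Set.eq_univ_of_forall fun x => ?_
    obtain ⟨n, hn⟩ := exists_nat_ge |x|
    exact Set.mem_iUnion.2 ⟨n, abs_le.1 hn⟩
  rw [hU, measure_univ] at h
  have h' := (ENNReal.tendsto_toReal ENNReal.one_ne_top).comp h
  obtain ⟨n, hn⟩ := (h'.eventually (lt_mem_nhds (show (1 / 2 : ℝ) < ENNReal.toReal 1 by
    norm_num))).exists
  exact ⟨n, by positivity, hn.le⟩

lemma PlasticInvariant.not_rajchman_of_branch {l p₀ p₁ p d : ℝ} {k : ℕ} {ν : Measure ℝ}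
    [IsProbabilityMeasure ν] (hl0 : 0 < l) (hl1 : l < 1) (hroot : l⁻¹ ^ 3 = l⁻¹ + 1)
    (hp0 : 0 < p₀) (hp1 : 0 < p₁) (hsum : p₀ + p₁ = 1) (hν : PlasticInvariant l p₀ p₁ ν)
    (hk : 0 < k) (hp : l ^ k < p)
    (hstep : ∀ s : Set ℝ, p * ν.real ((fun x => l ^ k * x + d) ⁻¹' s) ≤ ν.real s) :
    ¬ Rajchman ν := by
  intro hraj
  have hinv : 1 < l⁻¹ := (one_lt_inv₀ hl0).2 hl1
  have hp' : 0 < p := lt_trans (by positivity) hp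
  obtain ⟨C, hC, happrox⟩ :=
    exists_abs_inv_pow_sub_int_le hl0 hl1 (sq_add_cube_eq_one hl0 hroot)
  obtain ⟨R, hR, hRν⟩ := exists_half_le_measureReal_Icc ν
  obtain ⟨D, hD, hnear⟩ := exists_int_near_of_mem_trackedSet (R := R) hl0 hl1 hC hR
  have main : ∀ M K : ℕ, 24 * D * l ^ (k * M) * K ≤ 1 →
      p₀ ^ 2 * p₁ * (p ^ (3 * M) * (1 / 2)) * (K : ℝ) ^ 3 ≤ 4 := by
    intro M K hK
    obtain ⟨c, hc⟩ := exists_center_measureReal_ge hl0 hp'.le hstep R (3 * M)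
    rw [show k * (3 * M) = 3 * (k * M) by ring] at hc
    set m := k * M
    have hcard : #(univ : Finset (Fin K × Fin K × Fin K)) = K ^ 3 := by
      simp; ring
    have := hraj.mul_card_le (univ : Finset (Fin K × Fin K × Fin K))
      (fun s => -((s.1 : ℕ) * (l⁻¹ ^ (2 * m + 0) * c) + (s.2.1 : ℕ) * (l⁻¹ ^ (2 * m + 1) * c)
        + (s.2.2 : ℕ) * (l⁻¹ ^ (2 * m + 2) * c)))
      (fun s => (s.1 : ℕ) + (s.2.1 : ℕ) * l⁻¹ + (s.2.2 : ℕ) * l⁻¹ ^ 2) ?_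
      (T := fun n => l⁻¹ ^ (n + (2 + 2 * m))) ?_
      (κ := p₀ ^ 2 * p₁ * (p ^ (3 * M) * (1 / 2)))
      (fun n => trackedSet l C {z | |z - c| ≤ R * l ^ (3 * m)} (n + 2)) ?_ ?_
    · rw [hcard] at this
      exact_mod_cast this
    · rintro ⟨s0, s1, s2⟩ - ⟨r0, r1, r2⟩ - h
      obtain ⟨h0, h1, h2⟩ := int_linear_independent hroot ((s0 : ℕ) - (r0 : ℕ) : ℤ)
        ((s1 : ℕ) - (r1 : ℕ) : ℤ) ((s2 : ℕ) - (r2 : ℕ) : ℤ) (by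
          push_cast
          simp only at h
          linarith)
      ext <;> simp only <;> omega
    · exact (tendsto_pow_atTop_atTop_of_one_lt hinv).comp (tendsto_add_atTop_nat _)
    · intro n
      refine le_trans ?_ (le_measureReal_trackedSet hl0 hC happrox hp0 hp1 hsum hν _ n)
      gcongr
      refine le_trans ?_ hc
      gcongr
    · rintro n x hx ⟨s0, s1, s2⟩ -
      obtain ⟨N0, hN0⟩ := hnear m (n + 2) c x hx 0 (by norm_num)
      obtain ⟨N1, hN1⟩ := hnear m (n + 2) c x hx 1 (by norm_num)
      obtain ⟨N2, hN2⟩ := hnear m (n + 2) c x hx 2 (by norm_num)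
      have bound : ∀ (s : Fin K) (y : ℝ), |y| ≤ D * l ^ m → |(s : ℕ) * y| ≤ 1 / 24 := by
        intro s y hy
        rw [abs_mul, Nat.abs_cast]
        have hs : ((s : ℕ) : ℝ) ≤ K := by exact_mod_cast s.2.le
        calc ((s : ℕ) : ℝ) * |y| ≤ K * (D * l ^ m) := by gcongr
          _ ≤ 1 / 24 := by linarith
      refine ⟨(s0 : ℕ) * N0 + (s1 : ℕ) * N1 + (s2 : ℕ) * N2, ?_⟩
      have hpow : ∀ i, l⁻¹ ^ (n + 2 + (2 * m + i)) = l⁻¹ ^ (n + (2 + 2 * m)) * l⁻¹ ^ i := by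
        intro i
        rw [← pow_add]
        congr 1
        ring
      rw [hpow] at hN0 hN1 hN2
      have b0 := bound s0 _ hN0
      have b1 := bound s1 _ hN1
      have b2 := bound s2 _ hN2
      push_cast
      refine le_trans (le_of_eq ?_) ((abs_add_three _ _ _).trans
        ((add_le_add (add_le_add b0 b1) b2).trans (by norm_num)))
      congr 1
      ring
  set A : ℝ := p₀ ^ 2 * p₁ * (1 / 2) * (1 / (48 * D)) ^ 3 with hA
  have hApos : 0 < A := by positivity
  have hratio : 1 < (p / l ^ k) ^ 3 :=
    one_lt_pow₀ ((one_lt_div (by positivity)).2 hp) (by norm_num)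
  have hev1 : ∀ᶠ M : ℕ in atTop, 4 / A < ((p / l ^ k) ^ 3) ^ M :=
    (tendsto_pow_atTop_atTop_of_one_lt hratio).eventually_gt_atTop _
  have hev2 : ∀ᶠ M : ℕ in atTop, (l ^ k) ^ M < 1 / (24 * D) :=
    (tendsto_pow_atTop_nhds_zero_of_lt_one (by positivity)
      (pow_lt_one₀ hl0.le hl1 hk.ne')).eventually_lt_const (by positivity)
  obtain ⟨M, h1, h2⟩ := (hev1.and hev2).exists
  set y : ℝ := 1 / (24 * D * l ^ (k * M)) with hy
  have hε : 0 < l ^ (k * M) := by positivity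
  rw [← pow_mul, lt_div_iff₀ (by positivity)] at h2
  have hy1 : 1 ≤ y := by
    rw [hy, le_div_iff₀ (by positivity)]
    linarith
  have hfl : y / 2 ≤ ⌊y⌋₊ := by
    have a1 := Nat.lt_floor_add_one y
    have a2 : (1 : ℝ) ≤ ⌊y⌋₊ := by exact_mod_cast (Nat.one_le_floor_iff y).2 hy1
    linarith
  have hM := main M ⌊y⌋₊ (by
    calc 24 * D * l ^ (k * M) * ⌊y⌋₊ ≤ 24 * D * l ^ (k * M) * y := by
          gcongr
          exact Nat.floor_le (by linarith)
      _ = 1 := by rw [hy]; field_simp)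
  have : A * ((p / l ^ k) ^ 3) ^ M ≤ 4 := by
    refine le_trans (le_trans (le_of_eq ?_)
      (mul_le_mul_of_nonneg_left (pow_le_pow_left₀ (by positivity) hfl 3) (by positivity))) hM
    have hpow : ((p / l ^ k) ^ 3) ^ M = p ^ (3 * M) / (l ^ (k * M)) ^ 3 := by
      rw [← pow_mul, div_pow, ← pow_mul, ← pow_mul]
      congr 2
      ring
    rw [hA, hy, hpow]
    generalize l ^ (k * M) = ε at hε
    field_simp
    norm_num
  rw [div_lt_iff₀ hApos] at h1
  linarith

lemma PlasticInvariant.not_rajchman {l p₀ p₁ : ℝ} {ν : Measure ℝ} [IsProbabilityMeasure ν]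
    (hl0 : 0 < l) (hl1 : l < 1) (hroot : l⁻¹ ^ 3 = l⁻¹ + 1)
    (hp0 : 0 < p₀) (hp1 : 0 < p₁) (hsum : p₀ + p₁ = 1) (hν : PlasticInvariant l p₀ p₁ ν)
    (hne : ¬ (p₀ = l ^ 2 ∧ p₁ = l ^ 3)) : ¬ Rajchman ν := by
  have hl := sq_add_cube_eq_one hl0 hroot
  rcases lt_trichotomy (l ^ 2) p₀ with h | h | h
  · refine hν.not_rajchman_of_branch (k := 2) (d := 0) hl0 hl1 hroot hp0 hp1 hsum (by norm_num) h
      fun s => ?_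
    simp only [add_zero]
    have := hν.add_le hp0.le hp1.le s
    have : 0 ≤ p₁ * ν.real ((fun x => l ^ 3 * x + 1) ⁻¹' s) := by positivity
    linarith
  · exact absurd ⟨h.symm, by linarith⟩ hne
  · refine hν.not_rajchman_of_branch (k := 3) (d := 1) hl0 hl1 hroot hp0 hp1 hsum (by norm_num)
      (show l ^ 3 < p₁ by linarith) fun s => ?_
    have := hν.add_le hp0.le hp1.le s
    have : 0 ≤ p₀ * ν.real ((fun x => l ^ 2 * x) ⁻¹' s) := by positivity
    linarith

lemma PlasticInvariant.measure_singleton {l p₀ p₁ : ℝ} {ν : Measure ℝ} (hl0 : 0 < l)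
    (hν : PlasticInvariant l p₀ p₁ ν) (x : ℝ) :
    ν {x} = ENNReal.ofReal p₀ * ν {x / l ^ 2} + ENNReal.ofReal p₁ * ν {(x - 1) / l ^ 3} := by
  conv_lhs => rw [hν]
  simp only [Measure.add_apply, Measure.smul_apply, smul_eq_mul]
  rw [Measure.map_apply (by fun_prop) (measurableSet_singleton x),
    Measure.map_apply (by fun_prop) (measurableSet_singleton x)]
  have h0 : (fun y => l ^ 2 * y) ⁻¹' {x} = {x / l ^ 2} := by
    ext y
    rw [Set.mem_preimage, Set.mem_singleton_iff, Set.mem_singleton_iff, eq_div_iff (by positivity),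
      mul_comm]
  have h1 : (fun y => l ^ 3 * y + 1) ⁻¹' {x} = {(x - 1) / l ^ 3} := by
    ext y
    rw [Set.mem_preimage, Set.mem_singleton_iff, Set.mem_singleton_iff, eq_div_iff (by positivity),
      mul_comm, eq_sub_iff_add_eq]
  rw [h0, h1]

lemma PlasticInvariant.measure_singleton_eq_zero {l p₀ p₁ : ℝ} {ν : Measure ℝ}
    [IsFiniteMeasure ν] (hl0 : 0 < l) (hl1 : l < 1) (hp0 : 0 < p₀) (hp1 : 0 < p₁)
    (hsum : p₀ + p₁ = 1) (hν : PlasticInvariant l p₀ p₁ ν) (x : ℝ) : ν {x} = 0 := by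
  by_contra hx
  set f : ℝ → ℝ := fun y => ν.real {y} with hf
  have hrec : ∀ y, f y = p₀ * f (y / l ^ 2) + p₁ * f ((y - 1) / l ^ 3) := by
    intro y
    simp only [hf, measureReal_def]
    rw [hν.measure_singleton hl0 y, ENNReal.toReal_add
      (ENNReal.mul_ne_top (by simp) (measure_ne_top _ _))
      (ENNReal.mul_ne_top (by simp) (measure_ne_top _ _)), ENNReal.toReal_mul, ENNReal.toReal_mul,
      ENNReal.toReal_ofReal hp0.le, ENNReal.toReal_ofReal hp1.le]
  have hfin : ∀ a : ℝ, 0 < a → {y | a ≤ f y}.Finite := by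
    intro a ha
    refine (Measure.finite_const_le_meas_of_disjoint_iUnion ν
      (ENNReal.ofReal_pos.2 ha) (As := fun y : ℝ => {y}) (fun y => measurableSet_singleton y)
      (fun y z hyz => Set.disjoint_singleton.2 hyz) (measure_ne_top _ _)).subset ?_
    intro y hy
    exact (ENNReal.ofReal_le_iff_le_toReal (measure_ne_top _ _)).2 hy
  have hfx : 0 < f x := ENNReal.toReal_pos hx (measure_ne_top _ _)
  obtain ⟨y, hy, hmax⟩ := Set.exists_max_image _ f (hfin _ hfx) ⟨x, le_refl (f x)⟩
  have hmax' : ∀ z, f z ≤ f y := by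
    intro z
    by_cases hz : f x ≤ f z
    · exact hmax z hz
    · exact (not_le.1 hz).le.trans hy
  have hfy : 0 < f y := hfx.trans_le hy
  have hclosed0 : ∀ z, f z = f y → f (z / l ^ 2) = f y := by
    intro z hz
    have h1 := hrec z
    have h2 := hmax' (z / l ^ 2)
    have h3 := hmax' ((z - 1) / l ^ 3)
    by_contra hne
    have h4 := lt_of_le_of_ne h2 hne
    nlinarith [mul_lt_mul_of_pos_left h4 hp0, mul_le_mul_of_nonneg_left h3 hp1.le]
  have hclosed1 : ∀ z, f z = f y → f ((z - 1) / l ^ 3) = f y := by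
    intro z hz
    have h1 := hrec z
    have h2 := hmax' (z / l ^ 2)
    have h3 := hmax' ((z - 1) / l ^ 3)
    by_contra hne
    have h4 := lt_of_le_of_ne h3 hne
    nlinarith [mul_lt_mul_of_pos_left h4 hp1, mul_le_mul_of_nonneg_left h2 hp0.le]
  have hzero : ∀ z, f z = f y → z = 0 := by
    intro z hz
    by_contra hz0
    have hiter : ∀ n : ℕ, f (z / (l ^ 2) ^ n) = f y := by
      intro n
      induction n with
      | zero => simpa using hz
      | succ n ih => rw [pow_succ, ← div_div]; exact hclosed0 _ ih
    refine Set.infinite_of_injective_forall_mem (f := fun n : ℕ => z / (l ^ 2) ^ n) ?_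
      (fun n => (hiter n).ge) (hfin _ hfy)
    intro m n hmn
    have h1 : (l ^ 2) ^ m = (l ^ 2) ^ n := by
      simp only at hmn
      have hm : (l ^ 2) ^ m ≠ 0 := by positivity
      have hn : (l ^ 2) ^ n ≠ 0 := by positivity
      rw [div_eq_div_iff hm hn] at hmn
      exact (mul_left_cancel₀ hz0 hmn).symm
    exact pow_right_injective₀ (by positivity) (by nlinarith : l ^ 2 ≠ 1) h1
  have hy0 := hzero y rfl
  have h1 := hzero _ (hclosed1 y rfl)
  rw [hy0] at h1
  have : (0 - 1 : ℝ) / l ^ 3 < 0 := div_neg_of_neg_of_pos (by norm_num) (by positivity)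
  linarith

lemma rajchman_of_absolutelyContinuous {μ : Measure ℝ} [IsFiniteMeasure μ] (h : μ ≪ volume) :
    Rajchman μ := by
  have h1 := (Real.tendsto_integral_exp_smul_cocompact
    (fun x => ((μ.rnDeriv volume x).toReal : ℂ))).comp
      (tendsto_neg_atTop_atBot.mono_right (atBot_le_cocompact (α := ℝ)))
  refine h1.congr fun t => ?_
  rw [FT, ← integral_rnDeriv_smul h]
  refine integral_congr_ae (.of_forall fun x => ?_)
  simp only [Circle.smul_def, Real.fourierChar_apply, smul_eq_mul, Complex.real_smul]
  rw [mul_comm]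
  congr 2
  push_cast
  ring

lemma map_affine_volume {a : ℝ} (ha : a ≠ 0) (b : ℝ) :
    (volume : Measure ℝ).map (fun x => a * x + b) = ENNReal.ofReal |a⁻¹| • volume := by
  have h1 : (fun x : ℝ => a * x + b) = (fun x => x + b) ∘ (fun x => a * x) := rfl
  rw [h1, ← Measure.map_map (by fun_prop) (by fun_prop), Real.map_volume_mul_left ha,
    Measure.map_smul, map_add_right_eq_self]

lemma affine_absolutelyContinuous {a : ℝ} (ha : a ≠ 0) (b : ℝ) :
    (volume : Measure ℝ).map (fun x => a * x + b) ≪ volume := by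
  rw [map_affine_volume ha]
  exact Measure.smul_absolutelyContinuous

lemma measurableEmbedding_affine {a : ℝ} (ha : a ≠ 0) (b : ℝ) :
    MeasurableEmbedding (fun x : ℝ => a * x + b) :=
  (affineHomeomorph a b ha).measurableEmbedding

lemma affine_mutuallySingular {a : ℝ} (ha : a ≠ 0) (b : ℝ) {μ : Measure ℝ}
    (hμ : μ.MutuallySingular volume) :
    (μ.map (fun x => a * x + b)).MutuallySingular volume := by
  refine ((measurableEmbedding_affine ha b).mutuallySingular_map hμ).mono_ac
    Measure.AbsolutelyContinuous.rfl ?_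
  have hinv : a⁻¹ ≠ 0 := inv_ne_zero ha
  have h1 := (affine_absolutelyContinuous hinv (-(a⁻¹ * b))).map
    (measurableEmbedding_affine ha b).measurable
  rw [Measure.map_map (by fun_prop) (by fun_prop)] at h1
  have h2 : (fun x => a * x + b) ∘ (fun x => a⁻¹ * x + -(a⁻¹ * b)) = id := by
    ext x
    simp only [Function.comp, id]
    field_simp
    ring
  rwa [h2, Measure.map_id] at h1

/-- The absolutely continuous part of an invariant measure is invariant. -/
lemma PlasticInvariant.withDensity_rnDeriv {l p₀ p₁ : ℝ} {ν : Measure ℝ} [IsFiniteMeasure ν]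
    (hl0 : 0 < l) (hν : PlasticInvariant l p₀ p₁ ν) :
    PlasticInvariant l p₀ p₁ (volume.withDensity (ν.rnDeriv volume)) := by
  set s := ν.singularPart volume with hs
  set w := volume.withDensity (ν.rnDeriv volume) with hw
  have hadd : ν = s + w := ν.haveLebesgueDecomposition_add volume
  have h2 : l ^ 2 ≠ 0 := by positivity
  have h3 : l ^ 3 ≠ 0 := by positivity
  set L : Measure ℝ → Measure ℝ := fun μ => ENNReal.ofReal p₀ • μ.map (fun x => l ^ 2 * x) +
    ENNReal.ofReal p₁ • μ.map (fun x => l ^ 3 * x + 1) with hL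
  have hLadd : ν = L s + L w := by
    conv_lhs => rw [hν]
    simp only [hL]
    conv_lhs => rw [hadd]
    rw [Measure.map_add _ _ (by fun_prop), Measure.map_add _ _ (by fun_prop), smul_add, smul_add]
    abel
  have hwac : w ≪ volume := withDensity_absolutelyContinuous _ _
  have hLw : L w ≪ volume := by
    refine Measure.AbsolutelyContinuous.add_left ?_ ?_
    · have := (hwac.map (f := fun x => l ^ 2 * x + 0) (by fun_prop)).trans
        (affine_absolutelyContinuous h2 0)
      simp only [add_zero] at this
      exact this.smul_left _
    · exact ((hwac.map (by fun_prop)).trans (affine_absolutelyContinuous h3 1)).smul_left _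
  have hLs : (L s).MutuallySingular volume := by
    have hss : s.MutuallySingular volume := ν.mutuallySingular_singularPart volume
    refine Measure.MutuallySingular.add_left ?_ ?_
    · have := affine_mutuallySingular h2 0 hss
      simp only [add_zero] at this
      exact this.smul _
    · exact (affine_mutuallySingular h3 1 hss).smul _
  have hfin : IsFiniteMeasure (L w) :=
    isFiniteMeasure_of_le ν (hLadd ▸ Measure.le_add_left le_rfl)
  have hdens : volume.withDensity ((L w).rnDeriv volume) = L w :=
    Measure.withDensity_rnDeriv_eq _ _ hLw
  have := Measure.eq_withDensity_rnDeriv (μ := ν) (ν := volume)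
    (Measure.measurable_rnDeriv (L w) volume) hLs (by rw [hdens]; exact hLadd)
  rw [hdens] at this
  exact this.symm

lemma PlasticInvariant.smul {l p₀ p₁ : ℝ} {ν : Measure ℝ} (hν : PlasticInvariant l p₀ p₁ ν)
    (c : ENNReal) : PlasticInvariant l p₀ p₁ (c • ν) := by
  unfold PlasticInvariant at hν ⊢
  conv_lhs => rw [hν]
  rw [Measure.map_smul, Measure.map_smul, smul_add, smul_comm c, smul_comm c]

lemma PlasticInvariant.mutuallySingular {l p₀ p₁ : ℝ} {ν : Measure ℝ} [IsFiniteMeasure ν]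
    (hl0 : 0 < l) (hl1 : l < 1) (hroot : l⁻¹ ^ 3 = l⁻¹ + 1)
    (hp0 : 0 < p₀) (hp1 : 0 < p₁) (hsum : p₀ + p₁ = 1) (hν : PlasticInvariant l p₀ p₁ ν)
    (hne : ¬ (p₀ = l ^ 2 ∧ p₁ = l ^ 3)) : ν.MutuallySingular volume := by
  set w := volume.withDensity (ν.rnDeriv volume) with hw
  by_cases h0 : w = 0
  · rw [Measure.haveLebesgueDecomposition_add ν volume, ← hw, h0, add_zero]
    exact ν.mutuallySingular_singularPart volume
  · exfalso
    have : NeZero w := ⟨h0⟩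
    have hfin : IsFiniteMeasure w := isFiniteMeasure_of_le ν (Measure.withDensity_rnDeriv_le _ _)
    have hinv := (hν.withDensity_rnDeriv hl0).smul (w Set.univ)⁻¹
    have hprob : IsProbabilityMeasure ((w Set.univ)⁻¹ • w) := inferInstance
    exact hinv.not_rajchman hl0 hl1 hroot hp0 hp1 hsum hne (rajchman_of_absolutelyContinuous
      ((withDensity_absolutelyContinuous _ _).smul_left _))

lemma PlasticInvariant.charFun_eq {l p₀ p₁ : ℝ} {ν : Measure ℝ} [IsFiniteMeasure ν]
    (hp0 : 0 ≤ p₀) (hp1 : 0 ≤ p₁) (hν : PlasticInvariant l p₀ p₁ ν) (t : ℝ) :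
    charFun ν t = p₀ * charFun ν (l ^ 2 * t)
      + p₁ * (Complex.exp (t * Complex.I) * charFun ν (l ^ 3 * t)) := by
  have hint : ∀ (μ : Measure ℝ) [IsFiniteMeasure μ],
      Integrable (fun x : ℝ => Complex.exp (t * x * Complex.I)) μ := by
    intro μ _
    refine Integrable.of_bound (by fun_prop) 1 (.of_forall fun x => ?_)
    rw [← Complex.ofReal_mul, Complex.norm_exp_ofReal_mul_I]
  conv_lhs => rw [hν]
  simp only [charFun_apply_real]
  rw [integral_add_measure ((hint _).smul_measure (by simp)) ((hint _).smul_measure (by simp)),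
    integral_smul_measure, integral_smul_measure,
    integral_map (by fun_prop) (by fun_prop), integral_map (by fun_prop) (by fun_prop),
    ENNReal.toReal_ofReal hp0, ENNReal.toReal_ofReal hp1, Complex.real_smul, Complex.real_smul]
  congr 2
  · congr 1 with x
    congr 1
    push_cast
    ring
  · rw [← integral_const_mul]
    congr 1 with x
    rw [← Complex.exp_add]
    congr 1
    push_cast
    ring

/-- The invariant probability measure is unique. -/
lemma PlasticInvariant.unique {l p₀ p₁ : ℝ} {μ ν : Measure ℝ} [IsProbabilityMeasure μ]
    [IsProbabilityMeasure ν] (hl0 : 0 < l) (hl1 : l < 1) (hp0 : 0 ≤ p₀) (hp1 : 0 ≤ p₁)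
    (hsum : p₀ + p₁ = 1) (hμ : PlasticInvariant l p₀ p₁ μ) (hν : PlasticInvariant l p₀ p₁ ν) :
    μ = ν := by
  set g : ℝ → ℝ := fun t => ‖charFun μ t - charFun ν t‖ with hg
  have hrec : ∀ t, g t ≤ p₀ * g (l ^ 2 * t) + p₁ * g (l ^ 3 * t) := by
    intro t
    simp only [hg]
    rw [hμ.charFun_eq hp0 hp1 t, hν.charFun_eq hp0 hp1 t]
    calc _ = ‖(p₀ : ℂ) * (charFun μ (l ^ 2 * t) - charFun ν (l ^ 2 * t)) + (p₁ : ℂ) *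
            (Complex.exp (t * Complex.I) * (charFun μ (l ^ 3 * t) - charFun ν (l ^ 3 * t)))‖ := by
          congr 1; ring
      _ ≤ _ := by
          refine (norm_add_le _ _).trans (le_of_eq ?_)
          rw [norm_mul, norm_mul, norm_mul, Complex.norm_exp_ofReal_mul_I, one_mul,
            Complex.norm_of_nonneg hp0, Complex.norm_of_nonneg hp1]
  have hg0 : g 0 = 0 := by simp [hg]
  have hgc : Continuous g := by
    simp only [hg]
    fun_prop
  have hzero : ∀ t, g t = 0 := by
    intro t
    refine le_antisymm (le_of_forall_pos_le_add fun ε hε => ?_) (norm_nonneg _)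
    rw [zero_add]
    obtain ⟨δ, hδ, hball⟩ := Metric.continuous_iff.1 hgc 0 ε hε
    have hind : ∀ (n : ℕ) (t : ℝ), (l ^ 2) ^ n * |t| < δ → g t ≤ ε := by
      intro n
      induction n with
      | zero =>
        intro t ht
        have := hball t (by simpa using ht)
        rw [hg0, Real.dist_eq, sub_zero] at this
        exact (le_abs_self _).trans this.le
      | succ n ih =>
        intro t ht
        have hpow : (l ^ 2) ^ n * (l ^ 2 * |t|) < δ := by rwa [← mul_assoc, ← pow_succ]
        have h2 := ih (l ^ 2 * t) (by rwa [abs_mul, abs_of_pos (by positivity : 0 < l ^ 2)])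
        have h3 := ih (l ^ 3 * t) (by
          rw [abs_mul, abs_of_pos (by positivity : 0 < l ^ 3)]
          refine lt_of_le_of_lt ?_ hpow
          have : l ^ 3 ≤ l ^ 2 := pow_le_pow_of_le_one hl0.le hl1.le (by norm_num)
          gcongr)
        calc g t ≤ p₀ * g (l ^ 2 * t) + p₁ * g (l ^ 3 * t) := hrec t
          _ ≤ p₀ * ε + p₁ * ε := by gcongr
          _ = ε := by rw [← add_mul, hsum, one_mul]
    have hlim : Tendsto (fun n : ℕ => (l ^ 2) ^ n * |t|) atTop (nhds 0) := by
      have := (tendsto_pow_atTop_nhds_zero_of_lt_one (by positivity : 0 ≤ l ^ 2)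
        (pow_lt_one₀ hl0.le hl1 two_ne_zero)).mul_const |t|
      rwa [zero_mul] at this
    obtain ⟨n, hn⟩ := (hlim.eventually_lt_const hδ).exists
    exact hind n t hn
  refine Measure.ext_of_charFun (funext fun t => ?_)
  exact sub_eq_zero.1 (norm_eq_zero.1 (hzero t))

lemma smul_map_affine_restrict_Icc {a : ℝ} (ha : 0 < a) (b u v : ℝ) :
    ENNReal.ofReal a • (volume.restrict (Set.Icc u v)).map (fun x => a * x + b)
      = volume.restrict (Set.Icc (a * u + b) (a * v + b)) := by
  have hpre : (fun x => a * x + b) ⁻¹' Set.Icc (a * u + b) (a * v + b) = Set.Icc u v := by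
    ext x
    simp [ha]
  rw [← hpre, ← (measurableEmbedding_affine ha.ne' b).restrict_map,
    map_affine_volume ha.ne', abs_of_pos (inv_pos.2 ha),
    Measure.restrict_smul, smul_smul, ← ENNReal.ofReal_mul ha.le, mul_inv_cancel₀ ha.ne',
    ENNReal.ofReal_one, one_smul]

lemma plasticInvariant_restrict_Icc {l : ℝ} (hl0 : 0 < l) (hl : l ^ 2 + l ^ 3 = 1) :
    PlasticInvariant l (l ^ 2) (l ^ 3) (volume.restrict (Set.Icc 0 (1 + l))) := by
  unfold PlasticInvariant
  have h0 := smul_map_affine_restrict_Icc (by positivity : 0 < l ^ 2) 0 0 (1 + l)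
  have h1 := smul_map_affine_restrict_Icc (by positivity : 0 < l ^ 3) 1 0 (1 + l)
  simp only [add_zero, mul_zero, zero_add] at h0 h1
  rw [h0, h1, show l ^ 2 * (1 + l) = 1 by linarith,
    show l ^ 3 * (1 + l) + 1 = 1 + l by linear_combination l * hl,
    Measure.restrict_congr_set (Ico_ae_eq_Icc (μ := volume) (a := (0 : ℝ)) (b := 1)).symm,
    ← Measure.restrict_union _ measurableSet_Icc,
    Set.Ico_union_Icc_eq_Icc zero_le_one (by linarith)]
  exact Set.disjoint_left.2 fun x hx hx' => absurd hx.2 (not_lt.2 hx'.1)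

/-- Let `1/λ` be the Plastic number (the real root of `X³ - X - 1`,
a Pisot number) and consider `φ₀ x = λ² x`, `φ₁ x = λ³ x + 1` with probability vector
`(p₀, p₁)`, `p₀, p₁ > 0`, `p₀ + p₁ = 1`, and invariant measure `ν`. If
`(p₀, p₁) = (λ², λ³)` then `ν = (1/(1+λ)) Lebesgue` restricted to `[0, 1+λ]`;
otherwise `ν` is continuous, singular with respect to Lebesgue measure, and not
Rajchman. -/
theorem stmt19 (lam : ℝ) (hlam0 : 0 < lam) (hlam1 : lam < 1)
    (hroot : lam⁻¹ ^ 3 = lam⁻¹ + 1) (hgt : 1 < lam⁻¹)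
    (p₀ p₁ : ℝ) (hp0 : 0 < p₀) (hp1 : 0 < p₁) (hsum : p₀ + p₁ = 1)
    (ν : Measure ℝ) [IsProbabilityMeasure ν]
    (hν : ν = ENNReal.ofReal p₀ • ν.map (fun x => lam ^ 2 * x) +
              ENNReal.ofReal p₁ • ν.map (fun x => lam ^ 3 * x + 1)) :
    ((p₀ = lam ^ 2 ∧ p₁ = lam ^ 3) →
      ν = ENNReal.ofReal (1 / (1 + lam)) • volume.restrict (Set.Icc 0 (1 + lam))) ∧
    (¬ (p₀ = lam ^ 2 ∧ p₁ = lam ^ 3) →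
      (∀ x : ℝ, ν {x} = 0) ∧ ν.MutuallySingular volume ∧ ¬ Rajchman ν) := by
  have hl := sq_add_cube_eq_one hlam0 hroot
  refine ⟨?_, fun hne => ⟨fun x => PlasticInvariant.measure_singleton_eq_zero hlam0 hlam1 hp0 hp1
    hsum hν x, PlasticInvariant.mutuallySingular hlam0 hlam1 hroot hp0 hp1 hsum hν hne,
    PlasticInvariant.not_rajchman hlam0 hlam1 hroot hp0 hp1 hsum hν hne⟩⟩
  rintro ⟨rfl, rfl⟩
  have hprob : IsProbabilityMeasure
      (ENNReal.ofReal (1 / (1 + lam)) • volume.restrict (Set.Icc 0 (1 + lam))) := by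
    constructor
    rw [Measure.smul_apply, Measure.restrict_apply_univ, Real.volume_Icc, smul_eq_mul,
      ← ENNReal.ofReal_mul (by positivity), sub_zero, one_div_mul_cancel (by positivity),
      ENNReal.ofReal_one]
  exact PlasticInvariant.unique hlam0 hlam1 hp0.le hp1.le hsum hν
    ((plasticInvariant_restrict_Icc hlam0 hl).smul _)
end
end
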